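/- Let G ∈ G(n,p) with log⁵ n ≪ d = p(n−1) ≤ n(1 − 3 log log n / log n). Let i ≥ 0 be the largest integer such that d^i = o(n), let c = d^{i+1}/n, and let η = log_n(d^i). If e^c > (log n)/(3 log log n), then asymptotically almost surely (η + o(1)) · (d^i/n + e^{−c})^{−1} · log n ≤ β(G) ≤ (1 + o(1)) · (d^i/n + e^{−c})^{−1} · log n. -/

import Mathlib

open Filter Real Asymptotics
open scoped Topology

/-- `R` is a resolving set of the graph `G`: every pair of distinct vertices is
distinguished by its distances to some vertex of `R`. -/
def Resolves {V : Type*} (G : SimpleGraph V) (R : Set V) : Prop :=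
  ∀ ⦃v w : V⦄, v ≠ w → ∃ u ∈ R, G.dist u v ≠ G.dist u w

/-- The metric dimension of a graph `G`: the smallest cardinality of a resolving set. -/
noncomputable def metricDim {V : Type*} (G : SimpleGraph V) : ℕ :=
  sInf {k : ℕ | ∃ R : Set V, R.Finite ∧ R.ncard = k ∧ Resolves G R}

/-- The `G(n,p)` probability weight of a single graph on `Fin n`. -/
noncomputable def gnpWeight (n : ℕ) (p : ℝ) (G : SimpleGraph (Fin n)) : ℝ :=
  p ^ Nat.card G.edgeSet * (1 - p) ^ (n.choose 2 - Nat.card G.edgeSet)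

/-- The probability of an event `A` under the binomial random graph `G(n,p)`. -/
noncomputable def gnpProb (n : ℕ) (p : ℝ) (A : Set (SimpleGraph (Fin n))) : ℝ :=
  ∑' G : SimpleGraph (Fin n), A.indicator (gnpWeight n p) G

/-- `S(v,i)`: the set of vertices at graph distance exactly `i` from `v`. -/
def gSphere {V : Type*} (G : SimpleGraph V) (v : V) (i : ℕ) : Set V :=
  {u | G.Reachable v u ∧ G.dist v u = i}

/-- `N(v,i)`: the set of vertices at graph distance at most `i` from `v`. -/
def gBall {V : Type*} (G : SimpleGraph V) (v : V) (i : ℕ) : Set V :=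
  {u | G.Reachable v u ∧ G.dist v u ≤ i}

/-- `S(V',i)`: union of the spheres around the vertices of `V'`. -/
def gSphereSet {V : Type*} (G : SimpleGraph V) (W : Set V) (i : ℕ) : Set V :=
  ⋃ v ∈ W, gSphere G v i

/-- `N(V',i)`: union of the balls around the vertices of `V'`. -/
def gBallSet {V : Type*} (G : SimpleGraph V) (W : Set V) (i : ℕ) : Set V :=
  ⋃ v ∈ W, gBall G v i

section

open Classical

/-! ### Expectations over the binomial random graph -/

/-- The expectation of `f` under the binomial random graph `G(n,p)`. -/
noncomputable def gnpExp (n : ℕ) (p : ℝ) (f : SimpleGraph (Fin n) → ℝ) : ℝ :=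
  ∑ G : SimpleGraph (Fin n), gnpWeight n p G * f G

lemma gnpProb_eq_gnpExp (n : ℕ) (p : ℝ) (A : Set (SimpleGraph (Fin n))) :
    gnpProb n p A = gnpExp n p (A.indicator 1) := by
  rw [gnpProb, gnpExp, tsum_fintype]
  refine Finset.sum_congr rfl fun G _ => ?_
  by_cases h : G ∈ A <;> simp [h]

lemma gnpWeight_nonneg {n : ℕ} {p : ℝ} (hp : 0 ≤ p) (hp' : p ≤ 1) (G : SimpleGraph (Fin n)) :
    0 ≤ gnpWeight n p G :=
  mul_nonneg (pow_nonneg hp _) (pow_nonneg (by linarith) _)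

lemma natCard_edgeSet {n : ℕ} (G : SimpleGraph (Fin n)) :
    Nat.card G.edgeSet = G.edgeFinset.card := by
  rw [Nat.card_eq_fintype_card, SimpleGraph.edgeFinset_card]

lemma sum_gnpWeight_disjoint {n : ℕ} {p : ℝ} (H : SimpleGraph (Fin n)) :
    ∑ G : SimpleGraph (Fin n) with Disjoint G H, gnpWeight n p G =
      (1 - p) ^ Nat.card H.edgeSet := by
  rw [natCard_edgeSet]
  have htop : (⊤ : SimpleGraph (Fin n)).edgeFinset.card = n.choose 2 := by
    simpa using SimpleGraph.card_edgeFinset_top_eq_card_choose_two (V := Fin n)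
  set S := (⊤ : SimpleGraph (Fin n)).edgeFinset \ H.edgeFinset with hS
  have hH : H.edgeFinset ⊆ (⊤ : SimpleGraph (Fin n)).edgeFinset :=
    SimpleGraph.edgeFinset_mono le_top
  have hcard : S.card + H.edgeFinset.card = n.choose 2 := by
    rw [hS, Finset.card_sdiff_add_card_eq_card hH, htop]
  have key : ∑ G : SimpleGraph (Fin n) with Disjoint G H, gnpWeight n p G =
      ∑ t ∈ S.powerset, (p ^ t.card * (1 - p) ^ (S.card - t.card)) *
        (1 - p) ^ H.edgeFinset.card := by
    refine Finset.sum_nbij' (fun G => G.edgeFinset)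
      (fun t => SimpleGraph.fromEdgeSet (t : Set (Sym2 (Fin n)))) ?_ ?_ ?_ ?_ ?_
    · intro G hG
      simp only [Finset.mem_filter, Finset.mem_univ, true_and] at hG
      rw [Finset.mem_powerset, hS, Finset.subset_sdiff]
      exact ⟨SimpleGraph.edgeFinset_mono le_top, by simpa using hG⟩
    · intro t ht
      rw [Finset.mem_powerset, hS, Finset.subset_sdiff] at ht
      simp only [Finset.mem_filter, Finset.mem_univ, true_and]
      rw [← SimpleGraph.disjoint_edgeSet, SimpleGraph.edgeSet_fromEdgeSet]
      have h2 := ht.2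
      rw [← Finset.disjoint_coe, SimpleGraph.coe_edgeFinset] at h2
      exact h2.mono_left Set.sdiff_subset
    · intro G _
      simp
    · intro t ht
      rw [Finset.mem_powerset, hS, Finset.subset_sdiff] at ht
      ext e
      have : e ∈ t → ¬ e.IsDiag := fun h => by
        have := ht.1 h
        simpa using this
      simp only [SimpleGraph.mem_edgeFinset, SimpleGraph.edgeSet_fromEdgeSet, Set.mem_sdiff,
        Finset.mem_coe]
      exact ⟨fun h => h.1, fun h => ⟨h, this h⟩⟩
    · intro G hG
      simp only [Finset.mem_filter, Finset.mem_univ, true_and] at hG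
      have hsub : G.edgeFinset ⊆ S := by
        rw [hS, Finset.subset_sdiff]
        exact ⟨SimpleGraph.edgeFinset_mono le_top, by simpa using hG⟩
      have := Finset.card_le_card hsub
      rw [gnpWeight, natCard_edgeSet, mul_assoc, ← pow_add]
      congr 2
      omega
  rw [key, ← Finset.sum_mul, Finset.sum_pow_mul_eq_add_pow]
  simp

lemma sum_gnpWeight (n : ℕ) (p : ℝ) : ∑ G : SimpleGraph (Fin n), gnpWeight n p G = 1 := by
  have := sum_gnpWeight_disjoint (p := p) (⊥ : SimpleGraph (Fin n))
  simpa using this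

lemma gnpExp_const (n : ℕ) (p a : ℝ) : gnpExp n p (fun _ => a) = a := by
  rw [gnpExp, ← Finset.sum_mul, sum_gnpWeight, one_mul]

lemma gnpExp_mono {n : ℕ} {p : ℝ} (hp : 0 ≤ p) (hp' : p ≤ 1) {f g : SimpleGraph (Fin n) → ℝ}
    (h : ∀ G, f G ≤ g G) : gnpExp n p f ≤ gnpExp n p g :=
  Finset.sum_le_sum fun G _ => mul_le_mul_of_nonneg_left (h G) (gnpWeight_nonneg hp hp' G)

lemma gnpExp_nonneg {n : ℕ} {p : ℝ} (hp : 0 ≤ p) (hp' : p ≤ 1) {f : SimpleGraph (Fin n) → ℝ}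
    (h : ∀ G, 0 ≤ f G) : 0 ≤ gnpExp n p f :=
  Finset.sum_nonneg fun G _ => mul_nonneg (gnpWeight_nonneg hp hp' G) (h G)

lemma gnpExp_const_mul (n : ℕ) (p a : ℝ) (f : SimpleGraph (Fin n) → ℝ) :
    gnpExp n p (fun G => a * f G) = a * gnpExp n p f := by
  rw [gnpExp, gnpExp, Finset.mul_sum]
  exact Finset.sum_congr rfl fun G _ => by ring

lemma gnpExp_add (n : ℕ) (p : ℝ) (f g : SimpleGraph (Fin n) → ℝ) :
    gnpExp n p (fun G => f G + g G) = gnpExp n p f + gnpExp n p g := by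
  simp only [gnpExp, mul_add, Finset.sum_add_distrib]

lemma gnpExp_sub (n : ℕ) (p : ℝ) (f g : SimpleGraph (Fin n) → ℝ) :
    gnpExp n p (fun G => f G - g G) = gnpExp n p f - gnpExp n p g := by
  simp only [gnpExp, mul_sub, Finset.sum_sub_distrib]

lemma gnpExp_sum {n : ℕ} {p : ℝ} {ι : Type*} (s : Finset ι) (f : ι → SimpleGraph (Fin n) → ℝ) :
    gnpExp n p (fun G => ∑ a ∈ s, f a G) = ∑ a ∈ s, gnpExp n p (f a) := by
  simp only [gnpExp, Finset.mul_sum]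
  rw [Finset.sum_comm]

lemma gnpProb_mono {n : ℕ} {p : ℝ} (hp : 0 ≤ p) (hp' : p ≤ 1) {A B : Set (SimpleGraph (Fin n))}
    (h : A ⊆ B) : gnpProb n p A ≤ gnpProb n p B := by
  rw [gnpProb_eq_gnpExp, gnpProb_eq_gnpExp]
  exact gnpExp_mono hp hp' fun G => Set.indicator_le_indicator_of_subset h (by simp) G

lemma gnpProb_nonneg {n : ℕ} {p : ℝ} (hp : 0 ≤ p) (hp' : p ≤ 1) (A : Set (SimpleGraph (Fin n))) :
    0 ≤ gnpProb n p A := by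
  rw [gnpProb_eq_gnpExp]
  exact gnpExp_nonneg hp hp' fun G => Set.indicator_nonneg (by simp) G

lemma gnpProb_empty (n : ℕ) (p : ℝ) : gnpProb n p ∅ = 0 := by
  simp [gnpProb]

lemma gnpProb_le_one {n : ℕ} {p : ℝ} (hp : 0 ≤ p) (hp' : p ≤ 1) (A : Set (SimpleGraph (Fin n))) :
    gnpProb n p A ≤ 1 := by
  rw [gnpProb_eq_gnpExp, ← gnpExp_const n p 1]
  refine gnpExp_mono hp hp' fun G => ?_
  by_cases h : G ∈ A <;> simp [h]

lemma gnpProb_compl (n : ℕ) (p : ℝ) (A : Set (SimpleGraph (Fin n))) :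
    gnpProb n p Aᶜ = 1 - gnpProb n p A := by
  rw [gnpProb_eq_gnpExp, gnpProb_eq_gnpExp, ← gnpExp_const n p 1, ← gnpExp_sub]
  congr 1
  ext G
  by_cases h : G ∈ A <;> simp [h]

lemma gnpProb_union_le {n : ℕ} {p : ℝ} (hp : 0 ≤ p) (hp' : p ≤ 1)
    (A B : Set (SimpleGraph (Fin n))) :
    gnpProb n p (A ∪ B) ≤ gnpProb n p A + gnpProb n p B := by
  simp only [gnpProb_eq_gnpExp, ← gnpExp_add]
  refine gnpExp_mono hp hp' fun G => ?_
  by_cases h : G ∈ A <;> by_cases h' : G ∈ B <;> simp [h, h']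

lemma gnpProb_biUnion_le {n : ℕ} {p : ℝ} (hp : 0 ≤ p) (hp' : p ≤ 1) {ι : Type*} (s : Finset ι)
    (A : ι → Set (SimpleGraph (Fin n))) {q : ℝ} (h : ∀ a ∈ s, gnpProb n p (A a) ≤ q) :
    gnpProb n p {G | ∃ a ∈ s, G ∈ A a} ≤ s.card * q := by
  have : gnpProb n p {G | ∃ a ∈ s, G ∈ A a} ≤ ∑ a ∈ s, gnpProb n p (A a) := by
    simp only [gnpProb_eq_gnpExp, ← gnpExp_sum]
    refine gnpExp_mono hp hp' fun G => ?_
    refine Set.indicator_apply_le' ?_ ?_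
    · rintro ⟨a, ha, hG⟩
      refine le_trans ?_ (Finset.single_le_sum
        (f := fun a => (A a).indicator (1 : SimpleGraph (Fin n) → ℝ) G) ?_ ha)
      · simp [hG]
      · exact fun _ _ => Set.indicator_nonneg (by simp) G
    · exact fun _ => Finset.sum_nonneg fun _ _ => Set.indicator_nonneg (by simp) G
  refine this.trans ?_
  have := Finset.sum_le_card_nsmul s _ q h
  simpa using this

/-! ### Exposing part of the edges -/

/-- The graph that agrees with `G` on the pairs in `K` and with `G'` on all other pairs. -/
def splice {V : Type*} (K G G' : SimpleGraph V) : SimpleGraph V := (G ⊓ K) ⊔ (G' \ K)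

lemma splice_adj {V : Type*} {K G G' : SimpleGraph V} {u v : V} :
    (splice K G G').Adj u v ↔ (G.Adj u v ∧ K.Adj u v) ∨ (G'.Adj u v ∧ ¬ K.Adj u v) := by
  simp [splice]

lemma splice_splice {V : Type*} (K G G' : SimpleGraph V) :
    splice K (splice K G G') (splice K G' G) = G := by
  ext u v
  simp only [splice_adj]
  tauto

lemma card_edgeFinset_splice {n : ℕ} (K G G' : SimpleGraph (Fin n)) :
    (splice K G G').edgeFinset.card + (splice K G' G).edgeFinset.card =
      G.edgeFinset.card + G'.edgeFinset.card := by
  have h : ∀ G G' : SimpleGraph (Fin n), (splice K G G').edgeFinset.card =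
      (G.edgeFinset ∩ K.edgeFinset).card + (G'.edgeFinset \ K.edgeFinset).card := by
    intro G G'
    have : (splice K G G').edgeFinset =
        (G.edgeFinset ∩ K.edgeFinset) ∪ (G'.edgeFinset \ K.edgeFinset) := by
      ext e
      induction e with
      | _ u v => simp [splice_adj]
    rw [this, Finset.card_union_of_disjoint]
    exact Finset.disjoint_left.2 fun e he he' =>
      (Finset.mem_sdiff.1 he').2 (Finset.mem_inter.1 he).2
  have h1 := Finset.card_inter_add_card_sdiff G.edgeFinset K.edgeFinset
  have h2 := Finset.card_inter_add_card_sdiff G'.edgeFinset K.edgeFinset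
  rw [h, h]
  omega

lemma gnpWeight_splice {n : ℕ} {p : ℝ} (K G G' : SimpleGraph (Fin n)) :
    gnpWeight n p (splice K G G') * gnpWeight n p (splice K G' G) =
      gnpWeight n p G * gnpWeight n p G' := by
  have hle : ∀ G : SimpleGraph (Fin n), G.edgeFinset.card ≤ n.choose 2 := fun G => by
    simpa using SimpleGraph.card_edgeFinset_le_card_choose_two (G := G)
  have h := card_edgeFinset_splice K G G'
  have key : ∀ a b : ℕ, a ≤ n.choose 2 → b ≤ n.choose 2 →
      (p ^ a * (1 - p) ^ (n.choose 2 - a)) * (p ^ b * (1 - p) ^ (n.choose 2 - b)) =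
        p ^ (a + b) * (1 - p) ^ (2 * n.choose 2 - (a + b)) := by
    intro a b ha hb
    rw [mul_mul_mul_comm, ← pow_add, ← pow_add]
    congr 2
    omega
  simp only [gnpWeight, natCard_edgeSet]
  rw [key _ _ (hle _) (hle _), key _ _ (hle _) (hle _), h]

/-- Exposing the edges of a set of pairs `K G` that it determines and then resampling the others
does not change the distribution. -/
lemma gnpExp_splice {n : ℕ} {p : ℝ} (K : SimpleGraph (Fin n) → SimpleGraph (Fin n))
    (hK : ∀ G G', K (splice (K G) G G') = K G) (f : SimpleGraph (Fin n) → ℝ) :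
    gnpExp n p f = gnpExp n p fun G => gnpExp n p fun G' => f (splice (K G) G G') := by
  have h1 : gnpExp n p f = ∑ x : SimpleGraph (Fin n) × SimpleGraph (Fin n),
      gnpWeight n p x.1 * gnpWeight n p x.2 * f x.1 := by
    rw [Fintype.sum_prod_type, gnpExp]
    refine Finset.sum_congr rfl fun G _ => ?_
    simp only
    rw [← Finset.sum_mul, ← Finset.mul_sum, sum_gnpWeight, mul_one]
  have h2 : (gnpExp n p fun G => gnpExp n p fun G' => f (splice (K G) G G')) =
      ∑ x : SimpleGraph (Fin n) × SimpleGraph (Fin n),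
      gnpWeight n p x.1 * gnpWeight n p x.2 * f (splice (K x.1) x.1 x.2) := by
    rw [Fintype.sum_prod_type, gnpExp]
    refine Finset.sum_congr rfl fun G _ => ?_
    rw [gnpExp, Finset.mul_sum]
    exact Finset.sum_congr rfl fun G' _ => by ring
  have hinv : Function.Involutive (fun x : SimpleGraph (Fin n) × SimpleGraph (Fin n) =>
      (splice (K x.1) x.1 x.2, splice (K x.1) x.2 x.1)) := by
    rintro ⟨G, G'⟩
    simp only [hK, splice_splice]
  rw [h1, h2, ← Equiv.sum_comp hinv.toPerm]
  refine Finset.sum_congr rfl fun x _ => ?_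
  simp only [Function.Involutive.coe_toPerm, gnpWeight_splice]

lemma gnpProb_le_of_splice {n : ℕ} {p q : ℝ} (hp : 0 ≤ p) (hp' : p ≤ 1)
    (K : SimpleGraph (Fin n) → SimpleGraph (Fin n))
    (hK : ∀ G G', K (splice (K G) G G') = K G) (A : Set (SimpleGraph (Fin n)))
    (h : ∀ G, gnpProb n p {G' | splice (K G) G G' ∈ A} ≤ q) : gnpProb n p A ≤ q := by
  rw [gnpProb_eq_gnpExp, gnpExp_splice K hK, ← gnpExp_const n p q]
  refine gnpExp_mono hp hp' fun G => ?_
  have := h G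
  rw [gnpProb_eq_gnpExp] at this
  exact this

lemma gnpExp_mul_of_indep {n : ℕ} {p : ℝ} (K : SimpleGraph (Fin n))
    (f g : SimpleGraph (Fin n) → ℝ)
    (hf : ∀ G G', f (splice K G G') = f G) (hg : ∀ G G', g (splice K G G') = g G') :
    gnpExp n p (fun G => f G * g G) = gnpExp n p f * gnpExp n p g := by
  rw [gnpExp_splice (fun _ => K) (fun _ _ => rfl)]
  simp only [hf, hg, gnpExp_const_mul]
  rw [mul_comm, ← gnpExp_const_mul]
  congr 1
  ext G
  ring

/-- The pairs with at least one endpoint in `X`. -/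
def touching {V : Type*} (X : Finset V) : SimpleGraph V where
  Adj u v := u ≠ v ∧ (u ∈ X ∨ v ∈ X)
  symm := ⟨fun _ _ h => ⟨h.1.symm, h.2.symm⟩⟩
  loopless := ⟨fun _ h => h.1 rfl⟩

lemma splice_touching_adj_left {V : Type*} {X : Finset V} {G G' : SimpleGraph V} {u v : V}
    (h : u ∈ X) : (splice (touching X) G G').Adj u v ↔ G.Adj u v := by
  rw [splice_adj]
  have hG : G.Adj u v → u ≠ v := fun h => h.ne
  have hG' : G'.Adj u v → u ≠ v := fun h => h.ne
  simp only [touching, h]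
  tauto

lemma splice_touching_adj_of_notMem {V : Type*} {X : Finset V} {G G' : SimpleGraph V} {u v : V}
    (hu : u ∉ X) (hv : v ∉ X) : (splice (touching X) G G').Adj u v ↔ G'.Adj u v := by
  rw [splice_adj]
  simp [touching, hu, hv]

/-- `f` depends only on the adjacency between `x` and the vertices of `Z`. -/
def DependsOnRow {V α : Type*} (Z : Finset V) (x : V) (f : SimpleGraph V → α) : Prop :=
  ∀ G G' : SimpleGraph V, (∀ z ∈ Z, G.Adj x z ↔ G'.Adj x z) → f G = f G'

lemma gnpExp_prod_rows {n : ℕ} {p : ℝ} {Z U : Finset (Fin n)} (hZU : Disjoint U Z)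
    (f : Fin n → SimpleGraph (Fin n) → ℝ) (hf : ∀ x ∈ U, DependsOnRow Z x (f x)) :
    gnpExp n p (fun G => ∏ x ∈ U, f x G) = ∏ x ∈ U, gnpExp n p (f x) := by
  induction U using Finset.induction_on with
  | empty => simp [gnpExp_const]
  | insert a s ha ih =>
    rw [Finset.disjoint_insert_left] at hZU
    simp only [Finset.prod_insert ha]
    rw [gnpExp_mul_of_indep (touching {a}), ih hZU.2 fun x hx => hf x (Finset.mem_insert_of_mem hx)]
    · intro G G'
      exact hf a (Finset.mem_insert_self _ _) _ _ fun z _ => splice_touching_adj_left (by simp)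
    · intro G G'
      refine Finset.prod_congr rfl fun x hx => ?_
      refine hf x (Finset.mem_insert_of_mem hx) _ _ fun z hz => ?_
      refine splice_touching_adj_of_notMem ?_ ?_
      · simp only [Finset.mem_singleton]
        rintro rfl
        exact ha hx
      · simp only [Finset.mem_singleton]
        rintro rfl
        exact hZU.1 hz

lemma gnpProb_no_nbr {n : ℕ} {p : ℝ} (x : Fin n) (T : Finset (Fin n)) (hx : x ∉ T) :
    gnpProb n p {G | ∀ z ∈ T, ¬ G.Adj x z} = (1 - p) ^ T.card := by
  set H : SimpleGraph (Fin n) := SimpleGraph.fromEdgeSet (T.image fun z => s(x, z)) with hH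
  have hE : H.edgeSet = ↑(T.image fun z => s(x, z)) := by
    ext e
    simp only [hH, SimpleGraph.edgeSet_fromEdgeSet, Set.mem_sdiff, Finset.mem_coe]
    refine ⟨fun h => h.1, fun h => ⟨h, ?_⟩⟩
    obtain ⟨z, hz, rfl⟩ := Finset.mem_image.1 h
    simp only [Sym2.diagSet, Set.mem_ofPred_eq, Sym2.mk_isDiag_iff]
    rintro rfl
    exact hx hz
  have hcard : Nat.card H.edgeSet = T.card := by
    rw [Nat.card_coe_set_eq, hE, Set.ncard_coe_finset, Finset.card_image_of_injective]
    exact fun a b hab => Sym2.congr_right.1 hab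
  rw [← hcard, ← sum_gnpWeight_disjoint, gnpProb, tsum_fintype, Finset.sum_filter]
  refine Finset.sum_congr rfl fun G _ => ?_
  rw [Set.indicator_apply]
  refine if_congr ?_ rfl rfl
  rw [← SimpleGraph.disjoint_edgeSet, hE, Set.disjoint_right]
  simp

/-! ### Correlation and concentration inequalities -/

lemma gnpProb_mul_le_of_isUpperSet {n : ℕ} {p : ℝ} (hp : 0 ≤ p) (hp' : p ≤ 1)
    {A B : Set (SimpleGraph (Fin n))} (hA : IsUpperSet A) (hB : IsUpperSet B) :
    gnpProb n p A * gnpProb n p B ≤ gnpProb n p (A ∩ B) := by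
  have hind : ∀ C : Set (SimpleGraph (Fin n)), 0 ≤ (C.indicator 1 : SimpleGraph (Fin n) → ℝ) :=
    fun C G => Set.indicator_nonneg (by simp) G
  have hmon : ∀ C : Set (SimpleGraph (Fin n)), IsUpperSet C →
      Monotone (C.indicator 1 : SimpleGraph (Fin n) → ℝ) := by
    intro C hC G G' hGG'
    by_cases h : G ∈ C
    · simp [h, hC hGG' h]
    · simpa [h] using hind C G'
  have := fkg (A.indicator 1 : SimpleGraph (Fin n) → ℝ) (B.indicator 1) (gnpWeight n p)
    (gnpWeight_nonneg hp hp') (hind A) (hind B) (hmon A hA) (hmon B hB) (by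
      intro a b
      have h := gnpWeight_splice (p := p) b a b
      have h1 : splice b a b = a ⊓ b := by simp [splice]
      have h2 : splice b b a = a ⊔ b := by
        simp [splice, sup_comm]
      rw [h1, h2] at h
      exact h.ge)
  rw [sum_gnpWeight, one_mul] at this
  simp only [gnpProb_eq_gnpExp, gnpExp]
  refine this.trans (le_of_eq (Finset.sum_congr rfl fun G _ => ?_))
  by_cases h : G ∈ A <;> by_cases h' : G ∈ B <;> simp [h, h']

lemma prod_gnpProb_le_of_isUpperSet {n : ℕ} {p : ℝ} (hp : 0 ≤ p) (hp' : p ≤ 1) {ι : Type*}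
    (S : Finset ι) (A : ι → Set (SimpleGraph (Fin n))) (hA : ∀ a, IsUpperSet (A a)) :
    ∏ a ∈ S, gnpProb n p (A a) ≤ gnpProb n p {G | ∀ a ∈ S, G ∈ A a} := by
  induction S using Finset.induction_on with
  | empty =>
    have : gnpProb n p Set.univ = 1 := by
      rw [← Set.compl_empty, gnpProb_compl, gnpProb_empty, sub_zero]
    simp [this]
  | insert a s ha ih =>
    rw [Finset.prod_insert ha]
    refine (mul_le_mul_of_nonneg_left ih (gnpProb_nonneg hp hp' _)).trans ?_
    refine (gnpProb_mul_le_of_isUpperSet hp hp' (hA a) ?_).trans ?_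
    · exact fun G G' h hG b hb => hA b h (hG b hb)
    · refine gnpProb_mono hp hp' ?_
      rintro G ⟨h1, h2⟩ b hb
      rcases Finset.mem_insert.1 hb with rfl | hb
      exacts [h1, h2 b hb]

lemma gnpExp_exp_count {n : ℕ} {p : ℝ} {Z U : Finset (Fin n)} (hZU : Disjoint U Z)
    (A : Fin n → Set (SimpleGraph (Fin n))) (hA : ∀ x ∈ U, DependsOnRow Z x (fun G => G ∈ A x))
    (s : ℝ) :
    gnpExp n p (fun G => Real.exp (s * (U.filter fun x => G ∈ A x).card)) =
      ∏ x ∈ U, (1 + (Real.exp s - 1) * gnpProb n p (A x)) := by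
  have h1 : ∀ G : SimpleGraph (Fin n), Real.exp (s * (U.filter fun x => G ∈ A x).card) =
      ∏ x ∈ U, (1 + (Real.exp s - 1) * (A x).indicator 1 G) := by
    intro G
    have : ∀ x ∈ U, (1 + (Real.exp s - 1) * (A x).indicator 1 G) =
        if G ∈ A x then Real.exp s else 1 := by
      intro x _
      by_cases h : G ∈ A x <;> simp [h]
    rw [Finset.prod_congr rfl this, Finset.prod_ite, Finset.prod_const, Finset.prod_const_one,
      mul_one, ← Real.exp_nat_mul, mul_comm]
  simp only [h1]
  rw [gnpExp_prod_rows hZU]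
  · refine Finset.prod_congr rfl fun x _ => ?_
    rw [gnpExp_add, gnpExp_const, gnpExp_const_mul, gnpProb_eq_gnpExp]
  · intro x hx G G' h
    have := hA x hx G G' h
    simp only [eq_iff_iff] at this
    simp only [Set.indicator_apply, this, Pi.one_apply]

lemma gnpProb_le_exp_mul {n : ℕ} {p : ℝ} (hp : 0 ≤ p) (hp' : p ≤ 1)
    {A : Set (SimpleGraph (Fin n))} {f : SimpleGraph (Fin n) → ℝ} {m : ℝ}
    (h : ∀ G ∈ A, m ≤ f G) :
    gnpProb n p A ≤ Real.exp (-m) * gnpExp n p (fun G => Real.exp (f G)) := by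
  rw [gnpProb_eq_gnpExp, ← gnpExp_const_mul]
  refine gnpExp_mono hp hp' fun G => ?_
  rw [← Real.exp_add]
  refine Set.indicator_apply_le' (fun hG => ?_) fun _ => (Real.exp_pos _).le
  have := h G hG
  simp only [Pi.one_apply]
  exact Real.one_le_exp (by linarith)

/-- Chernoff's bound for the lower tail. -/
lemma gnpProb_count_le {n : ℕ} {p : ℝ} (hp : 0 ≤ p) (hp' : p ≤ 1) {Z U : Finset (Fin n)}
    (hZU : Disjoint U Z) (A : Fin n → Set (SimpleGraph (Fin n)))
    (hA : ∀ x ∈ U, DependsOnRow Z x (fun G => G ∈ A x)) {q b : ℝ} (hb : 0 ≤ b) (hb' : b ≤ 1)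
    (hq : ∀ x ∈ U, q ≤ gnpProb n p (A x)) (hq0 : 0 ≤ q) :
    gnpProb n p {G | ((U.filter fun x => G ∈ A x).card : ℝ) ≤ (1 - b) * (U.card * q)} ≤
      Real.exp (-(b ^ 2 / 4 * (U.card * q))) := by
  have hs := abs_le.1 (Real.abs_exp_sub_one_sub_id_le (x := -(b / 2))
    (by rw [abs_neg, abs_of_nonneg] <;> linarith))
  have hs1 : Real.exp (-(b / 2)) ≤ 1 := Real.exp_le_one_iff.2 (by linarith)
  refine (gnpProb_le_exp_mul hp hp' (m := -(b / 2) * ((1 - b) * (U.card * q)))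
    (f := fun G => -(b / 2) * (U.filter fun x => G ∈ A x).card) ?_).trans ?_
  · intro G hG
    exact mul_le_mul_of_nonpos_left hG (by linarith)
  · rw [gnpExp_exp_count hZU A hA]
    have h1 : ∏ x ∈ U, (1 + (Real.exp (-(b / 2)) - 1) * gnpProb n p (A x)) ≤
        ∏ _x ∈ U, Real.exp ((-(b / 2) + (b / 2) ^ 2) * q) := by
      refine Finset.prod_le_prod (fun x hx => ?_) fun x hx => ?_
      · have := gnpProb_le_one hp hp' (A x)
        have := gnpProb_nonneg hp hp' (A x)
        nlinarith [Real.exp_pos (-(b / 2))]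
      · have h2 := hq x hx
        have h3 := Real.add_one_le_exp ((-(b / 2) + (b / 2) ^ 2) * q)
        have h4 : (Real.exp (-(b / 2)) - 1) * gnpProb n p (A x) ≤
            (Real.exp (-(b / 2)) - 1) * q := mul_le_mul_of_nonpos_left h2 (by linarith)
        have h5 : (Real.exp (-(b / 2)) - 1) * q ≤ (-(b / 2) + (b / 2) ^ 2) * q :=
          mul_le_mul_of_nonneg_right (by nlinarith) hq0
        linarith
    refine (mul_le_mul_of_nonneg_left h1 (Real.exp_pos _).le).trans (le_of_eq ?_)
    rw [Finset.prod_const, ← Real.exp_nat_mul, ← Real.exp_add]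
    congr 1
    ring

/-- Chernoff's bound for the upper tail. -/
lemma gnpProb_le_count {n : ℕ} {p : ℝ} (hp : 0 ≤ p) (hp' : p ≤ 1) {Z U : Finset (Fin n)}
    (hZU : Disjoint U Z) (A : Fin n → Set (SimpleGraph (Fin n)))
    (hA : ∀ x ∈ U, DependsOnRow Z x (fun G => G ∈ A x)) {m b : ℝ} (hb : 0 ≤ b) (hb' : b ≤ 1)
    (hm : ∑ x ∈ U, gnpProb n p (A x) ≤ m) :
    gnpProb n p {G | (1 + b) * m ≤ ((U.filter fun x => G ∈ A x).card : ℝ)} ≤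
      Real.exp (-(b ^ 2 / 4 * m)) := by
  have hs := abs_le.1 (Real.abs_exp_sub_one_sub_id_le (x := b / 2)
    (by rw [abs_of_nonneg] <;> linarith))
  have hs1 : 1 ≤ Real.exp (b / 2) := Real.one_le_exp (by linarith)
  refine (gnpProb_le_exp_mul hp hp' (m := (b / 2) * ((1 + b) * m))
    (f := fun G => (b / 2) * (U.filter fun x => G ∈ A x).card) ?_).trans ?_
  · intro G hG
    exact mul_le_mul_of_nonneg_left hG (by linarith)
  · rw [gnpExp_exp_count hZU A hA]
    have h1 : ∏ x ∈ U, (1 + (Real.exp (b / 2) - 1) * gnpProb n p (A x)) ≤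
        ∏ x ∈ U, Real.exp ((b / 2 + (b / 2) ^ 2) * gnpProb n p (A x)) := by
      have h0 : ∀ x, 0 ≤ gnpProb n p (A x) := fun x => gnpProb_nonneg hp hp' (A x)
      refine Finset.prod_le_prod (fun x hx => ?_) fun x hx => ?_
      · nlinarith [h0 x]
      · have h3 := Real.add_one_le_exp ((b / 2 + (b / 2) ^ 2) * gnpProb n p (A x))
        have h5 : (Real.exp (b / 2) - 1) * gnpProb n p (A x) ≤
            (b / 2 + (b / 2) ^ 2) * gnpProb n p (A x) :=
          mul_le_mul_of_nonneg_right (by nlinarith) (h0 x)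
        linarith
    refine (mul_le_mul_of_nonneg_left h1 (Real.exp_pos _).le).trans ?_
    rw [← Real.exp_sum, ← Real.exp_add, ← Finset.mul_sum]
    refine Real.exp_le_exp.2 ?_
    have := mul_le_mul_of_nonneg_left hm (by positivity : 0 ≤ b / 2 + (b / 2) ^ 2)
    linarith

/-! ### Breadth-first search -/

/-- The set of vertices at distance less than `j` from `R`. -/
noncomputable def reach {V : Type*} [Fintype V] [DecidableEq V] (G : SimpleGraph V)
    (R : Finset V) : ℕ → Finset V
  | 0 => ∅
  | j + 1 => R ∪ Finset.univ.filter fun v => ∃ u ∈ reach G R j, G.Adj u v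

section

variable {V : Type*} [Fintype V] [DecidableEq V]

lemma reach_zero (G : SimpleGraph V) (R : Finset V) : reach G R 0 = ∅ := rfl

lemma mem_reach_succ {G : SimpleGraph V} {R : Finset V} {j : ℕ} {v : V} :
    v ∈ reach G R (j + 1) ↔ v ∈ R ∨ ∃ u ∈ reach G R j, G.Adj u v := by
  simp [reach]

lemma reach_one (G : SimpleGraph V) (R : Finset V) : reach G R 1 = R := by
  ext v
  simp [mem_reach_succ, reach_zero]

lemma reach_subset_succ (G : SimpleGraph V) (R : Finset V) (j : ℕ) :
    reach G R j ⊆ reach G R (j + 1) := by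
  induction j with
  | zero => simp [reach_zero]
  | succ j ih =>
    intro v hv
    rw [mem_reach_succ] at hv ⊢
    exact hv.imp_right fun ⟨u, hu, h⟩ => ⟨u, ih hu, h⟩

lemma reach_mono (G : SimpleGraph V) (R : Finset V) : Monotone (reach G R) :=
  monotone_nat_of_le_succ (reach_subset_succ G R)

lemma reach_mono_left (G : SimpleGraph V) {R R' : Finset V} (h : R' ⊆ R) (j : ℕ) :
    reach G R' j ⊆ reach G R j := by
  induction j with
  | zero => simp [reach_zero]
  | succ j ih =>
    intro v hv
    rw [mem_reach_succ] at hv ⊢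
    exact hv.imp (fun hv => h hv) fun ⟨u, hu, h⟩ => ⟨u, ih hu, h⟩

lemma mem_reach_iff {G : SimpleGraph V} {R : Finset V} {j : ℕ} {x : V} :
    x ∈ reach G R j ↔ ∃ v ∈ R, x ∈ reach G {v} j := by
  induction j generalizing x with
  | zero => simp [reach_zero]
  | succ j ih =>
    simp only [mem_reach_succ, Finset.mem_singleton]
    constructor
    · rintro (h | ⟨u, hu, h⟩)
      · exact ⟨x, h, Or.inl rfl⟩
      · obtain ⟨v, hv, huv⟩ := ih.1 hu
        exact ⟨v, hv, Or.inr ⟨u, huv, h⟩⟩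
    · rintro ⟨v, hv, rfl | ⟨u, hu, h⟩⟩
      · exact Or.inl hv
      · exact Or.inr ⟨u, ih.2 ⟨v, hv, hu⟩, h⟩

lemma mem_reach_singleton {G : SimpleGraph V} {v x : V} {j : ℕ} :
    x ∈ reach G {v} (j + 1) ↔ G.Reachable v x ∧ G.dist v x ≤ j := by
  have key : x ∈ reach G {v} (j + 1) ↔ ∃ w : G.Walk v x, w.length ≤ j := by
    induction j generalizing x with
    | zero =>
      rw [reach_one, Finset.mem_singleton]
      constructor
      · rintro rfl
        exact ⟨SimpleGraph.Walk.nil, le_rfl⟩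
      · rintro ⟨w, hw⟩
        exact (SimpleGraph.Walk.eq_of_length_eq_zero (p := w) (by omega)).symm
    | succ j ih =>
      rw [mem_reach_succ, Finset.mem_singleton]
      constructor
      · rintro (rfl | ⟨u, hu, h⟩)
        · exact ⟨SimpleGraph.Walk.nil, by simp⟩
        · obtain ⟨w, hw⟩ := ih.1 hu
          exact ⟨w.concat h, by rw [SimpleGraph.Walk.length_concat]; omega⟩
      · rintro ⟨w, hw⟩
        rcases Nat.eq_zero_or_pos w.length with h0 | h0
        · exact Or.inl (SimpleGraph.Walk.eq_of_length_eq_zero h0).symm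
        · right
          have hnil : ¬ w.Nil := by
            rw [SimpleGraph.Walk.not_nil_iff_lt_length]
            exact h0
          refine ⟨w.penultimate, ih.2 ⟨w.dropLast, ?_⟩, w.adj_penultimate hnil⟩
          have := SimpleGraph.Walk.length_dropLast_add_one hnil
          omega
  rw [key]
  constructor
  · rintro ⟨w, hw⟩
    exact ⟨w.reachable, (SimpleGraph.dist_le w).trans hw⟩
  · rintro ⟨h, hd⟩
    obtain ⟨w, hw⟩ := h.exists_walk_length_eq_dist
    exact ⟨w, hw.le.trans hd⟩

lemma reach_splice (G G' : SimpleGraph V) {R R' : Finset V} (hR : R' ⊆ R) {j k : ℕ}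
    (hk : k ≤ j + 1) :
    reach (splice (touching (reach G R j)) G G') R' k = reach G R' k := by
  induction k with
  | zero => rfl
  | succ k ih =>
    have ih := ih (by omega)
    ext v
    rw [mem_reach_succ, mem_reach_succ, ih]
    refine or_congr_right (exists_congr fun u => and_congr_right fun hu => ?_)
    exact splice_touching_adj_left
      (reach_mono G R (by omega : k ≤ j) (reach_mono_left G hR k hu))

/-- Breadth-first search from `R` up to depth `j` is a stopping set of pairs. -/
lemma touching_reach_splice (R : Finset V) (j : ℕ) (G G' : SimpleGraph V) :
    touching (reach (splice (touching (reach G R j)) G G') R j) = touching (reach G R j) := by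
  rw [reach_splice G G' le_rfl (Nat.le_succ j)]

lemma mem_reach_splice_succ (G G' : SimpleGraph V) {R R' : Finset V} (hR : R' ⊆ R) {j : ℕ}
    {x : V} (hx : x ∉ reach G R (j + 1)) :
    x ∈ reach (splice (touching (reach G R j)) G G') R' (j + 2) ↔
      ∃ z ∈ reach G R' (j + 1) \ reach G R j, G'.Adj x z := by
  have hxR : x ∉ R' := fun h => hx (mem_reach_succ.2 (Or.inl (hR h)))
  have hx' : x ∉ reach G R j := fun h => hx (reach_subset_succ G R j h)
  rw [mem_reach_succ, reach_splice G G' hR le_rfl]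
  simp only [hxR, false_or, Finset.mem_sdiff]
  constructor
  · rintro ⟨z, hz, h⟩
    by_cases hzj : z ∈ reach G R j
    · rw [splice_touching_adj_left hzj] at h
      exact absurd (mem_reach_succ.2 (Or.inr ⟨z, hzj, h⟩)) hx
    · rw [splice_touching_adj_of_notMem hzj hx'] at h
      exact ⟨z, ⟨hz, hzj⟩, h.symm⟩
  · rintro ⟨z, ⟨hz, hzj⟩, h⟩
    exact ⟨z, hz, (splice_touching_adj_of_notMem hzj hx').2 h.symm⟩

end

/-- The set of vertices at distance exactly `j` from `R`. -/
noncomputable def layer {V : Type*} [Fintype V] [DecidableEq V] (G : SimpleGraph V)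
    (R : Finset V) (j : ℕ) : Finset V :=
  reach G R (j + 1) \ reach G R j

lemma card_reach_succ {V : Type*} [Fintype V] [DecidableEq V] (G : SimpleGraph V)
    (R : Finset V) (j : ℕ) :
    (reach G R (j + 1)).card = (reach G R j).card + (layer G R j).card := by
  rw [layer, add_comm (Finset.card _), Finset.card_sdiff_add_card_eq_card (reach_subset_succ G R j)]

lemma gnpProb_inter_le_of_expose {n : ℕ} {p q : ℝ} (hp : 0 ≤ p) (hp' : p ≤ 1) (hq : 0 ≤ q)
    (R : Finset (Fin n)) (j : ℕ) {H B : Set (SimpleGraph (Fin n))}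
    (hH : ∀ G G', splice (touching (reach G R j)) G G' ∈ H → G ∈ H)
    (hB : ∀ G ∈ H, gnpProb n p {G' | splice (touching (reach G R j)) G G' ∈ B} ≤ q) :
    gnpProb n p (H ∩ B) ≤ q := by
  refine gnpProb_le_of_splice hp hp' (fun G => touching (reach G R j))
    (touching_reach_splice R j) _ fun G => ?_
  by_cases hG : G ∈ H
  · exact (gnpProb_mono hp hp' fun G' hG' => hG'.2).trans (hB G hG)
  · refine le_trans (le_of_eq ?_) hq
    rw [← gnpProb_empty n p]
    congr 1
    ext G'
    simp only [Set.mem_ofPred_eq, Set.mem_empty_iff_false, iff_false]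
    exact fun h => hG (hH G G' h.1)

lemma layer_splice {n : ℕ} (G G' : SimpleGraph (Fin n)) (R : Finset (Fin n)) (j : ℕ) :
    layer (splice (touching (reach G R j)) G G') R j = layer G R j := by
  rw [layer, layer, reach_splice G G' le_rfl le_rfl, reach_splice G G' le_rfl (by omega)]

lemma gnpProb_exists_nbr {n : ℕ} {p : ℝ} (x : Fin n) (T : Finset (Fin n)) (hx : x ∉ T) :
    gnpProb n p {G | ∃ z ∈ T, G.Adj x z} = 1 - (1 - p) ^ T.card := by
  rw [← gnpProb_no_nbr x T hx, ← gnpProb_compl]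
  congr 1
  ext G
  simp

lemma dependsOnRow_exists {n : ℕ} {Z T : Finset (Fin n)} (hT : T ⊆ Z) (x : Fin n) :
    DependsOnRow Z x (fun G => ∃ z ∈ T, G.Adj x z) := by
  intro G G' h
  simp only [eq_iff_iff]
  exact exists_congr fun z => and_congr_right fun hz => h z (hT hz)

lemma one_sub_pow_le_exp {p : ℝ} (hp' : p ≤ 1) (k : ℕ) : (1 - p) ^ k ≤ Real.exp (-(p * k)) := by
  have := pow_le_pow_left₀ (by linarith) (Real.one_sub_le_exp_neg p) k
  rwa [← Real.exp_nat_mul, mul_comm, neg_mul] at this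

/-- One step of breadth-first search multiplies the size of the layer by about `n * p`. -/
lemma gnpProb_layer_step {n : ℕ} {p γ : ℝ} (hp : 0 ≤ p) (hp' : p ≤ 1) (hγ : 0 ≤ γ)
    (hγ' : γ ≤ 1 / 4) (R : Finset (Fin n)) (j : ℕ) :
    gnpProb n p ({G | 1 ≤ (layer G R j).card ∧ ((reach G R (j + 1)).card : ℝ) ≤ γ * n ∧
        p * (layer G R j).card ≤ γ} ∩
      {G | ¬ ((1 - γ) ^ 3 * (n * p * (layer G R j).card) ≤ (layer G R (j + 1)).card ∧
        ((layer G R (j + 1)).card : ℝ) ≤ (1 + γ) * (n * p * (layer G R j).card))}) ≤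
      2 * Real.exp (-(γ ^ 2 * (n * p) / 16)) := by
  refine gnpProb_inter_le_of_expose hp hp' (by positivity) R j ?_ ?_
  · intro G G' h
    simpa only [Set.mem_ofPred_eq, layer_splice, reach_splice G G' le_rfl (le_refl (j + 1))] using h
  rintro G ⟨h1, h2, h3⟩
  set L := layer G R j with hL
  set O := (reach G R (j + 1))ᶜ with hO
  have hOL : Disjoint O L := by
    rw [Finset.disjoint_left]
    intro x hx hx'
    exact (Finset.mem_compl.1 hx) (Finset.mem_sdiff.1 hx').1
  have hOcard : (1 - γ) * n ≤ (O.card : ℝ) := by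
    have := Finset.card_add_card_compl (reach G R (j + 1))
    rw [Fintype.card_fin] at this
    have h' : ((reach G R (j + 1)).card : ℝ) + O.card = n := by exact_mod_cast this
    linarith
  have hOn : (O.card : ℝ) ≤ n := by
    have := Finset.card_le_univ O
    rw [Fintype.card_fin] at this
    exact_mod_cast this
  obtain ⟨A, hA⟩ : ∃ A : Fin n → Set (SimpleGraph (Fin n)),
      A = fun x => {G' | ∃ z ∈ L, G'.Adj x z} := ⟨_, rfl⟩
  have hdep : ∀ x ∈ O, DependsOnRow L x (fun G' => G' ∈ A x) :=
    fun x _ => hA ▸ dependsOnRow_exists subset_rfl x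
  have hprob : ∀ x ∈ O, gnpProb n p (A x) = 1 - (1 - p) ^ L.card :=
    fun x hx => hA ▸ gnpProb_exists_nbr x L (Finset.disjoint_left.1 hOL hx)
  have hnew : ∀ G', (layer (splice (touching (reach G R j)) G G') R (j + 1)).card =
      (O.filter fun x => G' ∈ A x).card := by
    intro G'
    congr 1
    ext x
    rw [layer, Finset.mem_sdiff, Finset.mem_filter, reach_splice G G' le_rfl le_rfl, and_comm, hO,
      Finset.mem_compl]
    refine and_congr_right fun hx => ?_
    rw [hA]
    exact mem_reach_splice_succ G G' le_rfl hx
  have hL1 : (1 : ℝ) ≤ L.card := by exact_mod_cast h1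
  have hpL : 0 ≤ p * L.card := by positivity
  have hqup : 1 - (1 - p) ^ L.card ≤ p * L.card := by
    have := one_add_mul_le_pow (a := -p) (by linarith) L.card
    rw [← sub_eq_add_neg] at this
    linarith
  have hqlow : p * L.card * (1 - γ) ≤ 1 - (1 - p) ^ L.card := by
    have h4 := one_sub_pow_le_exp hp' L.card
    have h5 := abs_le.1 (Real.abs_exp_sub_one_sub_id_le (x := -(p * L.card))
      (by rw [abs_neg, abs_of_nonneg hpL]; linarith))
    nlinarith
  have hnp : 0 ≤ (n : ℝ) * p := by positivity
  have hnpL : (n : ℝ) * p ≤ n * p * L.card := by nlinarith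
  have low := gnpProb_count_le hp hp' hOL A hdep hγ (by linarith)
    (fun x hx => by rw [hprob x hx]; exact hqlow) (mul_nonneg hpL (by linarith))
  have up := gnpProb_le_count hp hp' hOL A hdep (m := n * p * L.card) hγ (by linarith) (by
    rw [Finset.sum_congr rfl hprob, Finset.sum_const, nsmul_eq_mul]
    have : (O.card : ℝ) * (1 - (1 - p) ^ L.card) ≤ n * (p * L.card) :=
      mul_le_mul hOn hqup (by nlinarith) (by positivity)
    linarith)
  have hmean : (1 - γ) ^ 2 * (n * p * L.card) ≤ O.card * (p * L.card * (1 - γ)) := by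
    have := mul_le_mul_of_nonneg_right hOcard (mul_nonneg hpL (by linarith : 0 ≤ 1 - γ))
    linarith
  calc gnpProb n p {G' | splice (touching (reach G R j)) G G' ∈ _}
      ≤ gnpProb n p ({G' | ((O.filter fun x => G' ∈ A x).card : ℝ) ≤
            (1 - γ) * (O.card * (p * L.card * (1 - γ)))} ∪
          {G' | (1 + γ) * (n * p * L.card) ≤ ((O.filter fun x => G' ∈ A x).card : ℝ)}) := by
        refine gnpProb_mono hp hp' fun G' hG' => ?_
        simp only [Set.mem_ofPred_eq, hnew, layer_splice] at hG'
        rw [not_and_or, not_le, not_le] at hG'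
        refine hG'.imp (fun h => ?_) fun h => h.le
        refine h.le.trans ?_
        have := mul_le_mul_of_nonneg_left hmean (by linarith : 0 ≤ 1 - γ)
        linarith
    _ ≤ _ := gnpProb_union_le hp hp' _ _
    _ ≤ Real.exp (-(γ ^ 2 * (n * p) / 16)) + Real.exp (-(γ ^ 2 * (n * p) / 16)) := by
        refine add_le_add (low.trans ?_) (up.trans ?_)
        · refine Real.exp_le_exp.2 ?_
          have h6 : n * p / 4 ≤ (O.card : ℝ) * (p * L.card * (1 - γ)) := by nlinarith
          nlinarith [sq_nonneg γ]
        · refine Real.exp_le_exp.2 ?_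
          nlinarith [sq_nonneg γ]
    _ = _ := by ring

lemma gnpProb_le_add {n : ℕ} {p b c : ℝ} (hp : 0 ≤ p) (hp' : p ≤ 1)
    {A B C : Set (SimpleGraph (Fin n))} (h : A ⊆ B ∪ C) (hB : gnpProb n p B ≤ b)
    (hC : gnpProb n p C ≤ c) : gnpProb n p A ≤ b + c :=
  (gnpProb_mono hp hp' h).trans ((gnpProb_union_le hp hp' B C).trans (add_le_add hB hC))

lemma layer_zero {V : Type*} [Fintype V] [DecidableEq V] (G : SimpleGraph V) (R : Finset V) :
    layer G R 0 = R := by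
  rw [layer, zero_add, reach_one, reach_zero, Finset.sdiff_empty]

lemma card_reach_le_of_layer {V : Type*} [Fintype V] [DecidableEq V] {G : SimpleGraph V}
    {R : Finset V} {d M : ℝ} (hd : 2 ≤ d) (hM : 0 ≤ M) {k : ℕ}
    (h : ∀ m ≤ k, ((layer G R m).card : ℝ) ≤ M * d ^ m) :
    ((reach G R (k + 1)).card : ℝ) ≤ M * (1 + 2 / d) * d ^ k := by
  have hd0 : 0 < d := by linarith
  induction k with
  | zero =>
    have := h 0 le_rfl
    rw [card_reach_succ, reach_zero, Finset.card_empty, zero_add]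
    have h2 : 0 ≤ M * (2 / d) := by positivity
    linarith
  | succ k ih =>
    have h1 := ih fun m hm => h m (by omega)
    have h2 := h (k + 1) le_rfl
    rw [card_reach_succ, Nat.cast_add]
    have h3 : M * (1 + 2 / d) * d ^ k ≤ M * (2 / d) * d ^ (k + 1) := by
      rw [pow_succ]
      have : M * (2 / d) * (d ^ k * d) = M * 2 * d ^ k := by field_simp
      rw [this]
      have h4 : 2 / d ≤ 1 := by rw [div_le_one hd0]; exact hd
      have : 0 ≤ M * d ^ k := by positivity
      nlinarith
    linarith

lemma one_add_pow_le {x : ℝ} (k : ℕ) (hx : 0 ≤ x) (hk : k * x ≤ 1) :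
    (1 + x) ^ k ≤ 1 + 2 * (k * x) := by
  have h1 : (1 + x) ^ k ≤ Real.exp (k * x) := by
    rw [Real.exp_nat_mul]
    exact pow_le_pow_left₀ (by linarith) (by linarith [Real.add_one_le_exp x]) k
  have hk0 : 0 ≤ k * x := by positivity
  have h2 := abs_le.1 (Real.abs_exp_sub_one_sub_id_le (x := k * x) (by rwa [abs_of_nonneg hk0]))
  nlinarith

lemma one_sub_le_pow {x : ℝ} (k : ℕ) (hx : x ≤ 1) : 1 - k * x ≤ (1 - x) ^ k := by
  have := one_add_mul_le_pow (a := -x) (by linarith) k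
  rw [← sub_eq_add_neg] at this
  linarith

/-- The sizes of all layers around a set of one or two vertices are concentrated. -/
lemma gnpProb_layers {n : ℕ} {p d γ : ℝ} {i : ℕ} (hp : 0 ≤ p) (hp' : p ≤ 1)
    (hd : d = p * ((n : ℝ) - 1)) (hd2 : 2 ≤ d) (hγ : 0 ≤ γ) (hγ' : i * γ ≤ 1 / 10)
    (hγi : γ ≤ 1 / 4) (hn : 1 ≤ γ * ((n : ℝ) - 1)) (hdi : 8 * d ^ i ≤ γ * n)
    (R : Finset (Fin n)) (hR : 1 ≤ R.card) (hR' : R.card ≤ 2) (K : ℕ) (hK : K ≤ i) :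
    gnpProb n p {G | ¬ ∀ k ≤ K, R.card * d ^ k * (1 - γ) ^ (3 * k) ≤ (layer G R k).card ∧
      ((layer G R k).card : ℝ) ≤ R.card * d ^ k * (1 + γ) ^ (2 * k)} ≤
      K * (2 * Real.exp (-(γ ^ 2 * d / 16))) := by
  have hnp : (n : ℝ) * p = d + p := by rw [hd]; ring
  have hpd : p ≤ γ * d := by
    rw [hd]
    nlinarith
  have hR1 : (1 : ℝ) ≤ R.card := by exact_mod_cast hR
  have hR2 : (R.card : ℝ) ≤ 2 := by exact_mod_cast hR'
  induction K with
  | zero =>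
    refine le_of_eq ?_
    rw [Nat.cast_zero, zero_mul, ← gnpProb_empty n p]
    congr 1
    ext G
    simp [layer_zero]
  | succ K ih =>
    have step := gnpProb_layer_step hp hp' hγ hγi R K
    have hup : (1 + γ) ^ (2 * K) ≤ 2 := by
      have hKi : ((2 * K : ℕ) : ℝ) * γ ≤ 1 / 5 := by
        have : ((K : ℕ) : ℝ) ≤ i := by exact_mod_cast (by omega : K ≤ i)
        push_cast
        nlinarith
      have := one_add_pow_le (2 * K) hγ (by linarith)
      linarith
    have hlow : 1 / 2 ≤ (1 - γ) ^ (3 * K) := by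
      have hKi : ((3 * K : ℕ) : ℝ) * γ ≤ 3 / 10 := by
        have : ((K : ℕ) : ℝ) ≤ i := by exact_mod_cast (by omega : K ≤ i)
        push_cast
        nlinarith
      have := one_sub_le_pow (x := γ) (3 * K) (by linarith)
      linarith
    have hdK : 8 * d ^ (K + 1) ≤ γ * n := by
      refine le_trans ?_ hdi
      have := pow_le_pow_right₀ (by linarith : 1 ≤ d) hK
      linarith
    have hdpos : 0 < d ^ K := by positivity
    rw [pow_succ] at hdK
    refine (gnpProb_le_add hp hp' ?_ (ih (by omega)) step).trans ?_
    · intro G hG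
      rw [Set.mem_union]
      by_contra hcon
      rw [not_or] at hcon
      obtain ⟨h1, h2⟩ := hcon
      refine h2 ?_
      have h1 : ∀ k ≤ K, R.card * d ^ k * (1 - γ) ^ (3 * k) ≤ (layer G R k).card ∧
        ((layer G R k).card : ℝ) ≤ R.card * d ^ k * (1 + γ) ^ (2 * k) := not_not.1 h1
      have hlay : ∀ m ≤ K, ((layer G R m).card : ℝ) ≤ 4 * d ^ m := by
        intro m hm
        refine (h1 m hm).2.trans ?_
        have h3 : (1 + γ) ^ (2 * m) ≤ 2 :=
          (pow_le_pow_right₀ (by linarith) (by omega)).trans hup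
        have h4 : 0 < d ^ m := by positivity
        calc R.card * d ^ m * (1 + γ) ^ (2 * m) ≤ (2 * d ^ m) * 2 := by gcongr
          _ = _ := by ring
      have hreach := card_reach_le_of_layer hd2 (by norm_num) hlay
      have h2d : 2 / d ≤ 1 := by rw [div_le_one (by linarith)]; exact hd2
      have hreach' : ((reach G R (K + 1)).card : ℝ) ≤ 8 * d ^ K := by nlinarith
      have hHist : 1 ≤ (layer G R K).card ∧ ((reach G R (K + 1)).card : ℝ) ≤ γ * n ∧
          p * (layer G R K).card ≤ γ := by
        refine ⟨?_, ?_, ?_⟩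
        · have h3 := (h1 K le_rfl).1
          have h4 : (0 : ℝ) < (layer G R K).card := by
            refine lt_of_lt_of_le ?_ h3
            have : 0 < (1 - γ) ^ (3 * K) := by linarith
            positivity
          exact_mod_cast h4
        · nlinarith
        · have hn1 : (0 : ℝ) < n := by
            have : 0 < γ * ((n : ℝ) - 1) := by linarith
            have : 0 < (n : ℝ) - 1 := by
              by_contra hneg
              nlinarith
            linarith
          have h3 := hlay K le_rfl
          have h4 : p * (layer G R K).card * n ≤ γ * n := by
            calc p * (layer G R K).card * n = (n * p) * (layer G R K).card := by ring
              _ ≤ (2 * d) * (4 * d ^ K) := by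
                rw [hnp]
                gcongr
                nlinarith
              _ ≤ γ * n := by linarith
          exact le_of_mul_le_mul_right h4 hn1
      refine ⟨hHist, fun hgood => hG fun k hk => ?_⟩
      rcases Nat.lt_or_ge K k with hk' | hk'
      · obtain rfl : k = K + 1 := by omega
        obtain ⟨h3, h4⟩ := h1 K le_rfl
        obtain ⟨h5, h6⟩ := hgood
        have hg0 : 0 ≤ 1 - γ := by linarith
        constructor
        · calc R.card * d ^ (K + 1) * (1 - γ) ^ (3 * (K + 1))
              = (1 - γ) ^ 3 * (d * (R.card * d ^ K * (1 - γ) ^ (3 * K))) := by ring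
            _ ≤ (1 - γ) ^ 3 * (n * p * (layer G R K).card) := by
              gcongr
              linarith
            _ ≤ _ := h5
        · calc ((layer G R (K + 1)).card : ℝ) ≤ _ := h6
            _ ≤ (1 + γ) * (((1 + γ) * d) * (R.card * d ^ K * (1 + γ) ^ (2 * K))) := by
                refine mul_le_mul_of_nonneg_left ?_ (by linarith)
                refine mul_le_mul ?_ h4 (Nat.cast_nonneg _) (by positivity)
                linarith
              _ = _ := by ring
      · exact h1 k hk'
    · have : Real.exp (-(γ ^ 2 * (n * p) / 16)) ≤ Real.exp (-(γ ^ 2 * d / 16)) := by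
        gcongr
        linarith
      push_cast
      linarith

/-- Balls of radius `i` have the expected sizes, and balls around two different vertices are
almost disjoint. -/
def SphereGood {n : ℕ} (G : SimpleGraph (Fin n)) (a d : ℝ) (i : ℕ) : Prop :=
  (∀ v, ((reach G {v} (i + 1)).card : ℝ) ≤ (1 + a) * d ^ i ∧
    ((reach G {v} i).card : ℝ) ≤ (1 + a) * d ^ (i - 1) ∧
    (1 - a) * d ^ i ≤ (layer G {v} i).card) ∧
  ∀ v w, v ≠ w → 2 * (1 - a) * d ^ i ≤ (layer G {v, w} i).card

lemma gnpProb_not_sphereGood {n : ℕ} {p d γ : ℝ} {i : ℕ} (hp : 0 ≤ p) (hp' : p ≤ 1)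
    (hi : 1 ≤ i) (hd : d = p * ((n : ℝ) - 1)) (hd2 : 2 ≤ d) (hγ : 0 ≤ γ) (hγ' : i * γ ≤ 1 / 10)
    (hn : 1 ≤ γ * ((n : ℝ) - 1)) (hdi : 8 * d ^ i ≤ γ * n) (hγd : 2 ≤ γ * d) :
    gnpProb n p {G | ¬ SphereGood G (8 * (i * γ)) d i} ≤
      n ^ 2 * (i * (2 * Real.exp (-(γ ^ 2 * d / 16)))) := by
  have hi1 : (1 : ℝ) ≤ i := by exact_mod_cast hi
  have hγi : γ ≤ i * γ := by nlinarith
  have hU : ((Finset.univ : Finset (Fin n × Fin n)).card : ℝ) = (n : ℝ) ^ 2 := by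
    rw [Finset.card_univ, Fintype.card_prod, Fintype.card_fin]
    push_cast
    ring
  have hcard : ∀ x : Fin n × Fin n, 1 ≤ ({x.1, x.2} : Finset (Fin n)).card ∧
      ({x.1, x.2} : Finset (Fin n)).card ≤ 2 := by
    intro x
    refine ⟨Finset.card_pos.2 ⟨x.1, by simp⟩, Finset.card_le_two⟩
  rw [← hU]
  refine (gnpProb_mono hp hp' ?_).trans (gnpProb_biUnion_le hp hp' Finset.univ _ fun x _ =>
    gnpProb_layers hp hp' hd hd2 hγ hγ' (by linarith) hn hdi ({x.1, x.2} : Finset (Fin n))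
      (hcard x).1 (hcard x).2 i le_rfl)
  intro G hG
  by_contra hcon
  simp only [Set.mem_ofPred_eq, not_exists, not_and, Finset.mem_univ, forall_true_left,
    not_not] at hcon
  refine hG ?_
  have hsing : ∀ v : Fin n, ∀ k ≤ i, d ^ k * (1 - γ) ^ (3 * k) ≤ (layer G {v} k).card ∧
      ((layer G {v} k).card : ℝ) ≤ d ^ k * (1 + γ) ^ (2 * k) := by
    intro v k hk
    have := hcon (v, v) k hk
    simpa using this
  have hlow : 1 - 8 * (i * γ) ≤ (1 - γ) ^ (3 * i) := by
    have := one_sub_le_pow (x := γ) (3 * i) (by linarith)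
    push_cast at this
    linarith
  have hup : ∀ k ≤ i, (1 + γ) ^ (2 * k) ≤ 1 + 4 * (i * γ) := by
    intro k hk
    refine (pow_le_pow_right₀ (by linarith) (by omega : 2 * k ≤ 2 * i)).trans ?_
    have := one_add_pow_le (2 * i) hγ (by push_cast; linarith)
    push_cast at this
    linarith
  have hdp : ∀ k, 0 < d ^ k := fun k => by positivity
  have h2d : 2 / d ≤ γ := by rw [div_le_iff₀ (by linarith)]; exact hγd
  have hball : ∀ v : Fin n, ∀ k ≤ i,
      ((reach G {v} (k + 1)).card : ℝ) ≤ (1 + 8 * (i * γ)) * d ^ k := by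
    intro v k hk
    refine (card_reach_le_of_layer (M := 1 + 4 * (i * γ)) hd2 (by linarith) ?_).trans ?_
    · intro m hm
      refine (hsing v m (by omega)).2.trans ?_
      rw [mul_comm]
      exact mul_le_mul_of_nonneg_right (hup m (by omega)) (hdp m).le
    · refine mul_le_mul_of_nonneg_right ?_ (hdp k).le
      have : (1 + 4 * (i * γ)) * (1 + 2 / d) ≤ (1 + 4 * (i * γ)) * (1 + γ) := by gcongr
      nlinarith
  refine ⟨fun v => ⟨hball v i le_rfl, ?_, ?_⟩, fun v w hvw => ?_⟩
  · obtain ⟨m, rfl⟩ : ∃ m, i = m + 1 := ⟨i - 1, by omega⟩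
    exact hball v m (by omega)
  · refine le_trans ?_ (hsing v i le_rfl).1
    rw [mul_comm]
    exact mul_le_mul_of_nonneg_left hlow (hdp i).le
  · have h1 := (hcon (v, w) i le_rfl).1
    rw [Finset.card_pair hvw] at h1
    refine le_trans ?_ h1
    have := mul_le_mul_of_nonneg_left hlow (hdp i).le
    push_cast
    linarith

lemma isUpperSet_exists_nbr {V : Type*} (x : V) (T : Finset V) :
    IsUpperSet {G : SimpleGraph V | ∃ z ∈ T, G.Adj x z} :=
  fun _ _ h ⟨z, hz, hG⟩ => ⟨z, hz, h hG⟩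

lemma card_compl_reach_ge {n : ℕ} {G : SimpleGraph (Fin n)} {R : Finset (Fin n)} {j : ℕ} {M : ℝ}
    (h : ((reach G R j).card : ℝ) ≤ M) : n - M ≤ ((reach G R j)ᶜ.card : ℝ) := by
  have := Finset.card_add_card_compl (reach G R j)
  rw [Fintype.card_fin] at this
  have h' : ((reach G R j).card : ℝ) + (reach G R j)ᶜ.card = n := by exact_mod_cast this
  linarith

/-- Two given vertices are unlikely to be at distance more than `i + 2`. -/
lemma gnpProb_far {n : ℕ} {p d a : ℝ} {i : ℕ} (hp : 0 ≤ p) (hp' : p ≤ 1) (hd : 0 ≤ d)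
    (ha : 0 ≤ a) (ha' : a ≤ 1 / 2) (hdi : 8 * d ^ i ≤ n) (hpd : 2 ≤ p * d ^ i) (hn : 16 ≤ n)
    (v w : Fin n) :
    gnpProb n p ({G | ((reach G {v} (i + 1)).card : ℝ) ≤ (1 + a) * d ^ i ∧
      (1 - a) * d ^ i ≤ (layer G {v} i).card} ∩ {G | w ∉ reach G {v} (i + 3)}) ≤
      Real.exp (-(n * p / 16)) := by
  have hn' : (16 : ℝ) ≤ n := by exact_mod_cast hn
  have hdp : 0 ≤ d ^ i := by positivity
  refine gnpProb_inter_le_of_expose hp hp' (by positivity) {v} i ?_ ?_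
  · intro G G' h
    simpa only [Set.mem_ofPred_eq, layer_splice, reach_splice G G' le_rfl (le_refl (i + 1))] using h
  rintro G ⟨h1, h2⟩
  by_cases hw : w ∈ reach G {v} (i + 1)
  · refine le_trans (le_of_eq ?_) (Real.exp_pos _).le
    rw [← gnpProb_empty n p]
    congr 1
    ext G'
    simp only [Set.mem_ofPred_eq, Set.mem_empty_iff_false, iff_false, not_not]
    refine reach_mono _ _ (by omega : i + 1 ≤ i + 3) ?_
    rwa [reach_splice G G' le_rfl le_rfl]
  set L := layer G {v} i with hL
  set O := (reach G {v} (i + 1))ᶜ with hO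
  have hwO : w ∈ O := Finset.mem_compl.2 hw
  have hOL : ∀ x ∈ O, x ∉ L := by
    intro x hx hx'
    exact (Finset.mem_compl.1 hx) (Finset.mem_sdiff.1 hx').1
  have hOcard : (n : ℝ) - n / 4 ≤ (O.card : ℝ) := by
    refine card_compl_reach_ge (h1.trans ?_)
    nlinarith
  have hU : (n : ℝ) / 2 ≤ (O.erase w).card := by
    have := Finset.card_erase_add_one hwO
    have h' : ((O.erase w).card : ℝ) + 1 = O.card := by exact_mod_cast this
    linarith
  obtain ⟨A, hA⟩ : ∃ A : Fin n → Set (SimpleGraph (Fin n)),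
      A = fun x => {G' | ∃ z ∈ ({w} : Finset (Fin n)), G'.Adj x z} ∩
        {G' | ∃ z ∈ L, G'.Adj x z} := ⟨_, rfl⟩
  have hUZ : Disjoint (O.erase w) (insert w L) := by
    rw [Finset.disjoint_left]
    intro x hx hx'
    rcases Finset.mem_insert.1 hx' with rfl | hx'
    · exact Finset.notMem_erase _ _ hx
    · exact hOL x (Finset.mem_of_mem_erase hx) hx'
  have hdep : ∀ x ∈ O.erase w, DependsOnRow (insert w L) x (fun G' => G' ∈ A x) := by
    intro x _ G₁ G₂ h
    rw [hA]
    exact congrArg₂ And (dependsOnRow_exists (by simp) x G₁ G₂ h)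
      (dependsOnRow_exists (Finset.subset_insert _ _) x G₁ G₂ h)
  have hhalf : (1 - p) ^ L.card ≤ 1 / 2 := by
    refine (one_sub_pow_le_exp hp' _).trans ?_
    have h3 : 1 ≤ p * (L.card : ℝ) := by
      have : p * ((1 - a) * d ^ i) ≤ p * L.card := mul_le_mul_of_nonneg_left h2 hp
      nlinarith
    have h4 : Real.exp (-(p * L.card)) ≤ Real.exp (-1) := Real.exp_le_exp.2 (by linarith)
    have h5 := Real.exp_neg_one_lt_half
    linarith
  have hprob : ∀ x ∈ O.erase w, p / 2 ≤ gnpProb n p (A x) := by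
    intro x hx
    have hxw : x ∉ ({w} : Finset (Fin n)) := by
      rw [Finset.mem_singleton]
      exact Finset.ne_of_mem_erase hx
    have := gnpProb_mul_le_of_isUpperSet hp hp' (isUpperSet_exists_nbr x {w})
      (isUpperSet_exists_nbr x L)
    rw [gnpProb_exists_nbr x _ hxw, gnpProb_exists_nbr x L (hOL x (Finset.mem_of_mem_erase hx)),
      Finset.card_singleton, pow_one, sub_sub_cancel] at this
    rw [hA]
    refine le_trans ?_ this
    nlinarith
  refine (gnpProb_mono hp hp' ?_).trans ((gnpProb_count_le hp hp' hUZ A hdep zero_le_one le_rfl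
    hprob (by positivity)).trans ?_)
  · intro G' hG'
    simp only [Set.mem_ofPred_eq, sub_self, zero_mul] at hG' ⊢
    refine le_of_eq ?_
    rw [Nat.cast_eq_zero, Finset.card_eq_zero, Finset.filter_eq_empty_iff]
    intro x hx hxA
    refine hG' ?_
    rw [hA] at hxA
    obtain ⟨⟨y, hy, hxw⟩, hxL⟩ := hxA
    rw [Finset.mem_singleton] at hy
    subst hy
    have hx1 : x ∉ reach G {v} (i + 1) := Finset.mem_compl.1 (Finset.mem_of_mem_erase hx)
    refine mem_reach_succ.2 (Or.inr ⟨x, (mem_reach_splice_succ G G' le_rfl hx1).2 hxL, ?_⟩)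
    rw [splice_touching_adj_of_notMem (fun h => hx1 (reach_subset_succ _ _ _ h))
      (fun h => hw (reach_subset_succ _ _ _ h))]
    exact hxw
  · refine Real.exp_le_exp.2 ?_
    nlinarith

/-- Every two vertices are at distance at most `i + 2`. -/
def NearAll {n : ℕ} (G : SimpleGraph (Fin n)) (i : ℕ) : Prop :=
  ∀ v w, w ∈ reach G {v} (i + 3)

lemma gnpProb_sphereGood_not_nearAll {n : ℕ} {p d a : ℝ} {i : ℕ} (hp : 0 ≤ p) (hp' : p ≤ 1)
    (hd : 0 ≤ d) (ha : 0 ≤ a) (ha' : a ≤ 1 / 2) (hdi : 8 * d ^ i ≤ n) (hpd : 2 ≤ p * d ^ i)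
    (hn : 16 ≤ n) :
    gnpProb n p {G | SphereGood G a d i ∧ ¬ NearAll G i} ≤ n ^ 2 * Real.exp (-(n * p / 16)) := by
  have hU : ((Finset.univ : Finset (Fin n × Fin n)).card : ℝ) = (n : ℝ) ^ 2 := by
    rw [Finset.card_univ, Fintype.card_prod, Fintype.card_fin]
    push_cast
    ring
  rw [← hU]
  refine (gnpProb_mono hp hp' ?_).trans (gnpProb_biUnion_le hp hp' Finset.univ _ fun x _ =>
    gnpProb_far hp hp' hd ha ha' hdi hpd hn x.1 x.2)
  rintro G ⟨hG, hfar⟩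
  simp only [NearAll, not_forall] at hfar
  obtain ⟨v, w, hvw⟩ := hfar
  exact ⟨(v, w), Finset.mem_univ _, ⟨(hG.1 v).1, (hG.1 v).2.2⟩, hvw⟩

lemma NearAll.reachable {n : ℕ} {G : SimpleGraph (Fin n)} {i : ℕ} (h : NearAll G i) (v w : Fin n) :
    G.Reachable v w :=
  (mem_reach_singleton.1 (h v w)).1

lemma NearAll.dist_le {n : ℕ} {G : SimpleGraph (Fin n)} {i : ℕ} (h : NearAll G i) (v w : Fin n) :
    G.dist v w ≤ i + 2 :=
  (mem_reach_singleton.1 (h v w)).2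

lemma NearAll.mem_reach_succ_iff {n : ℕ} {G : SimpleGraph (Fin n)} {i : ℕ} (h : NearAll G i)
    {v x : Fin n} {j : ℕ} : x ∈ reach G {v} (j + 1) ↔ G.dist v x ≤ j := by
  rw [mem_reach_singleton, and_iff_right (h.reachable v x)]

/-! ### The upper bound -/

/-- The set of vertices that distinguish `v` from `w`. -/
noncomputable def distinguishing {n : ℕ} (G : SimpleGraph (Fin n)) (v w : Fin n) :
    Finset (Fin n) :=
  Finset.univ.filter fun u => G.dist u v ≠ G.dist u w

lemma metricDim_le_card {V : Type*} {G : SimpleGraph V} {R : Finset V} (h : Resolves G R) :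
    metricDim G ≤ R.card :=
  Nat.sInf_le ⟨R, R.finite_toSet, Set.ncard_coe_finset R, h⟩

/-- If every pair is distinguished by many vertices, then a random set is resolving. -/
lemma metricDim_le_of_distinguishing {n m : ℕ} {s : ℝ} (hn : 0 < n) {G : SimpleGraph (Fin n)}
    (h : ∀ v w, v ≠ w → s ≤ (distinguishing G v w).card)
    (hm : 2 * n * Real.log n < s * m) : metricDim G ≤ m := by
  have hn' : (0 : ℝ) < n := by exact_mod_cast hn
  by_contra hcon
  have hf : ∀ f : Fin m → Fin n, ∃ x : Fin n × Fin n, x.1 ≠ x.2 ∧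
      ∀ j, f j ∈ (distinguishing G x.1 x.2)ᶜ := by
    intro f
    by_contra hne
    push Not at hne
    refine hcon ((metricDim_le_card (R := Finset.univ.image f) ?_).trans
      (Finset.card_image_le.trans_eq (by simp)))
    intro v w hvw
    obtain ⟨j, hj⟩ := hne (v, w) hvw
    refine ⟨f j, by simp, ?_⟩
    simpa [distinguishing] using hj
  have hcard : ∀ x : Fin n × Fin n, x.1 ≠ x.2 →
      ((Fintype.piFinset fun _ : Fin m => (distinguishing G x.1 x.2)ᶜ).card : ℝ) ≤
        n ^ m * Real.exp (-(s * m / n)) := by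
    intro x hx
    have h1 : (n : ℝ) - s ≥ ((distinguishing G x.1 x.2)ᶜ.card : ℝ) := by
      have h2 := Finset.card_add_card_compl (distinguishing G x.1 x.2)
      rw [Fintype.card_fin] at h2
      have h3 : ((distinguishing G x.1 x.2).card : ℝ) + (distinguishing G x.1 x.2)ᶜ.card = n := by
        exact_mod_cast h2
      have := h x.1 x.2 hx
      linarith
    rw [Fintype.card_piFinset, Finset.prod_const, Finset.card_univ, Fintype.card_fin,
      Nat.cast_pow]
    have h4 : (n : ℝ) - s ≤ n * Real.exp (-(s / n)) := by
      have h5 := mul_le_mul_of_nonneg_left (Real.one_sub_le_exp_neg (s / n)) hn'.le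
      have h6 : (n : ℝ) * (1 - s / n) = n - s := by field_simp
      linarith
    calc (((distinguishing G x.1 x.2)ᶜ.card : ℝ)) ^ m ≤ (n * Real.exp (-(s / n))) ^ m :=
          pow_le_pow_left₀ (Nat.cast_nonneg _) (h1.le.trans h4) m
      _ = n ^ m * Real.exp (-(s * m / n)) := by
          rw [mul_pow, ← Real.exp_nat_mul]
          congr 2
          ring
  set P := (Finset.univ : Finset (Fin n × Fin n)).filter fun x => x.1 ≠ x.2 with hP
  have hsub : (Finset.univ : Finset (Fin m → Fin n)) ⊆
      P.biUnion fun x => Fintype.piFinset fun _ : Fin m => (distinguishing G x.1 x.2)ᶜ := by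
    intro f _
    obtain ⟨x, hx, hfx⟩ := hf f
    rw [Finset.mem_biUnion]
    exact ⟨x, by simpa [hP] using hx, Fintype.mem_piFinset.2 hfx⟩
  have hcount := (Finset.card_le_card hsub).trans Finset.card_biUnion_le
  have hcount' : (n : ℝ) ^ m ≤ n ^ 2 * (n ^ m * Real.exp (-(s * m / n))) := by
    have h1 : ((n ^ m : ℕ) : ℝ) ≤ ∑ x ∈ P,
        ((Fintype.piFinset fun _ : Fin m => (distinguishing G x.1 x.2)ᶜ).card : ℝ) := by
      rw [← Nat.cast_sum, Nat.cast_le]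
      refine le_trans (le_of_eq ?_) hcount
      simp
    rw [Nat.cast_pow] at h1
    refine h1.trans ((Finset.sum_le_sum fun x hx => hcard x (Finset.mem_filter.1 hx).2).trans ?_)
    rw [Finset.sum_const, nsmul_eq_mul]
    refine mul_le_mul_of_nonneg_right ?_ (by positivity)
    have h2 := Finset.card_le_univ P
    rw [Fintype.card_prod, Fintype.card_fin] at h2
    have h3 : (P.card : ℝ) ≤ n * n := by exact_mod_cast h2
    linarith
  have hexp : (n : ℝ) ^ 2 * Real.exp (-(s * m / n)) < 1 := by
    have h1 : (n : ℝ) ^ 2 = Real.exp (2 * Real.log n) := by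
      rw [← Real.exp_log hn', Real.log_exp, ← Real.exp_nat_mul]
      norm_num
    rw [h1, ← Real.exp_add, Real.exp_lt_one_iff]
    have : 2 * Real.log n < s * m / n := by
      rw [lt_div_iff₀ hn']
      linarith
    linarith
  have hpos : (0 : ℝ) < n ^ m := by positivity
  nlinarith

lemma card_near_distinguishing {n : ℕ} {G : SimpleGraph (Fin n)} {i : ℕ} {d a : ℝ}
    (hG : NearAll G i) {v w : Fin n}
    (hv : ((reach G {v} (i + 1)).card : ℝ) ≤ (1 + a) * d ^ i)
    (hw : ((reach G {w} (i + 1)).card : ℝ) ≤ (1 + a) * d ^ i)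
    (hL : 2 * (1 - a) * d ^ i ≤ (layer G {v, w} i).card) :
    (2 - 6 * a) * d ^ i ≤
      (distinguishing G v w ∩ reach G {v, w} (i + 1)).card := by
  set A := reach G {v} (i + 1)
  set B := reach G {w} (i + 1)
  have hAB : reach G {v, w} (i + 1) = A ∪ B := by
    ext x
    simp [mem_reach_iff (R := {v, w}), A, B]
  have hsub : (A ∪ B) \ (A ∩ B) ⊆ distinguishing G v w ∩ reach G {v, w} (i + 1) := by
    intro x hx
    rw [Finset.mem_sdiff] at hx
    rw [hAB, Finset.mem_inter]
    refine ⟨?_, hx.1⟩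
    simp only [distinguishing, Finset.mem_filter, Finset.mem_univ, true_and]
    intro hd
    rw [SimpleGraph.dist_comm, SimpleGraph.dist_comm (u := x)] at hd
    simp only [A, B, Finset.mem_union, Finset.mem_inter, hG.mem_reach_succ_iff, hd] at hx
    tauto
  have h1 := Finset.card_le_card hsub
  have h2 := Finset.card_sdiff_add_card_eq_card
    (Finset.inter_subset_left.trans Finset.subset_union_left : A ∩ B ⊆ A ∪ B)
  have h3 := Finset.card_union_add_card_inter A B
  have h4 : (layer G {v, w} i).card ≤ (A ∪ B).card := by
    rw [← hAB]
    exact Finset.card_le_card Finset.sdiff_subset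
  have h2' : (((A ∪ B) \ (A ∩ B)).card : ℝ) + (A ∩ B).card = (A ∪ B).card := by exact_mod_cast h2
  have h3' : ((A ∪ B).card : ℝ) + (A ∩ B).card = A.card + B.card := by exact_mod_cast h3
  have h4' : ((layer G {v, w} i).card : ℝ) ≤ (A ∪ B).card := by exact_mod_cast h4
  have h1' : (((A ∪ B) \ (A ∩ B)).card : ℝ) ≤
    (distinguishing G v w ∩ reach G {v, w} (i + 1)).card := by exact_mod_cast h1
  linarith

lemma gnpProb_exactly_one {n : ℕ} {p : ℝ} (hp : 0 ≤ p) (hp' : p ≤ 1) (x : Fin n)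
    (A B : Finset (Fin n)) (hx : x ∉ A ∪ B) :
    (1 - p) ^ A.card + (1 - p) ^ B.card - 2 * (1 - p) ^ (A ∪ B).card ≤
      gnpProb n p {G | ¬ ((∃ z ∈ A, G.Adj x z) ↔ ∃ z ∈ B, G.Adj x z)} := by
  have hxA : x ∉ A := fun h => hx (Finset.mem_union_left _ h)
  have hxB : x ∉ B := fun h => hx (Finset.mem_union_right _ h)
  rw [← gnpProb_no_nbr x A hxA, ← gnpProb_no_nbr x B hxB, ← gnpProb_no_nbr x _ hx]
  simp only [gnpProb_eq_gnpExp]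
  rw [← gnpExp_add, ← gnpExp_const_mul, ← gnpExp_sub]
  refine gnpExp_mono hp hp' fun G => ?_
  have hno : ∀ T : Finset (Fin n), (∀ z ∈ T, ¬ G.Adj x z) ↔ ¬ ∃ z ∈ T, G.Adj x z :=
    fun T => by simp
  have hun : (∃ z ∈ A ∪ B, G.Adj x z) ↔ (∃ z ∈ A, G.Adj x z) ∨ ∃ z ∈ B, G.Adj x z := by
    simp only [Finset.mem_union, or_and_right, exists_or]
  simp only [Set.indicator_apply, Set.mem_ofPred_eq, Pi.one_apply, hno, hun]
  by_cases hA : ∃ z ∈ A, G.Adj x z <;> by_cases hB : ∃ z ∈ B, G.Adj x z <;>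
    simp only [hA, hB] <;> norm_num

lemma gnpProb_few_distinguishing {n : ℕ} {p d a b q : ℝ} {i : ℕ} (hp : 0 ≤ p) (hp' : p ≤ 1)
    (hb : 0 ≤ b) (hb' : b ≤ 1) (hq0 : 0 ≤ q)
    (hq : ∀ k l : ℕ, (k : ℝ) ≤ (1 + a) * d ^ i → 2 * (1 - a) * d ^ i ≤ l →
      q ≤ 2 * ((1 - p) ^ k - (1 - p) ^ l)) (v w : Fin n) :
    gnpProb n p ({G | ((reach G {v} (i + 1)).card : ℝ) ≤ (1 + a) * d ^ i ∧
      ((reach G {w} (i + 1)).card : ℝ) ≤ (1 + a) * d ^ i ∧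
      2 * (1 - a) * d ^ i ≤ (layer G {v, w} i).card} ∩
      {G | NearAll G i ∧ ((distinguishing G v w).card : ℝ) ≤
        (2 - 6 * a) * d ^ i + (1 - b) * ((n - 2 * (1 + a) * d ^ i) * q)}) ≤
      Real.exp (-(b ^ 2 / 4 * ((n - 2 * (1 + a) * d ^ i) * q))) := by
  have hv : ({v} : Finset (Fin n)) ⊆ {v, w} := by simp
  have hw : ({w} : Finset (Fin n)) ⊆ {v, w} := by simp
  refine gnpProb_inter_le_of_expose hp hp' (by positivity) {v, w} i ?_ ?_
  · intro G G' h
    simpa only [Set.mem_ofPred_eq, layer_splice, reach_splice G G' hv (le_refl (i + 1)),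
      reach_splice G G' hw (le_refl (i + 1))] using h
  rintro G ⟨h1, h2, h3⟩
  set A := reach G {v} (i + 1) \ reach G {v, w} i with hA
  set B := reach G {w} (i + 1) \ reach G {v, w} i with hB
  set O := (reach G {v, w} (i + 1))ᶜ with hO
  have hU : reach G {v, w} (i + 1) = reach G {v} (i + 1) ∪ reach G {w} (i + 1) := by
    ext x
    simp [mem_reach_iff (R := {v, w})]
  have hAB : A ∪ B = layer G {v, w} i := by
    rw [layer, hU, Finset.union_sdiff_distrib]
  have hOL : ∀ x ∈ O, x ∉ A ∪ B := by
    intro x hx hx'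
    rw [hAB] at hx'
    exact (Finset.mem_compl.1 hx) (Finset.mem_sdiff.1 hx').1
  have hOcard : (n : ℝ) - 2 * (1 + a) * d ^ i ≤ (O.card : ℝ) := by
    refine card_compl_reach_ge ?_
    have := Finset.card_union_le (reach G {v} (i + 1)) (reach G {w} (i + 1))
    have h' : ((reach G {v, w} (i + 1)).card : ℝ) ≤
        (reach G {v} (i + 1)).card + (reach G {w} (i + 1)).card := by
      rw [hU]
      exact_mod_cast this
    linarith
  obtain ⟨E, hE⟩ : ∃ E : Fin n → Set (SimpleGraph (Fin n)),
      E = fun x => {G | ¬ ((∃ z ∈ A, G.Adj x z) ↔ ∃ z ∈ B, G.Adj x z)} := ⟨_, rfl⟩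
  have hdep : ∀ x ∈ O, DependsOnRow (A ∪ B) x (fun G' => G' ∈ E x) := by
    intro x _ G₁ G₂ h
    have e1 := dependsOnRow_exists (Finset.subset_union_left (s₁ := A) (s₂ := B)) x G₁ G₂ h
    have e2 := dependsOnRow_exists (Finset.subset_union_right (s₁ := A) (s₂ := B)) x G₁ G₂ h
    simp only at e1 e2
    simp only [hE, Set.mem_ofPred_eq, e1, e2]
  have hprob : ∀ x ∈ O, q ≤ gnpProb n p (E x) := by
    intro x hx
    rw [hE]
    refine le_trans ?_ (gnpProb_exactly_one hp hp' x A B (hOL x hx))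
    have hA' : (A.card : ℝ) ≤ (1 + a) * d ^ i :=
      le_trans (by exact_mod_cast Finset.card_le_card Finset.sdiff_subset) h1
    have hB' : (B.card : ℝ) ≤ (1 + a) * d ^ i :=
      le_trans (by exact_mod_cast Finset.card_le_card Finset.sdiff_subset) h2
    rw [← hAB] at h3
    have := hq _ _ hA' h3
    have := hq _ _ hB' h3
    linarith
  refine (gnpProb_mono hp hp' ?_).trans ((gnpProb_count_le hp hp'
    (Finset.disjoint_left.2 hOL) E hdep hb hb' hprob hq0).trans ?_)
  · rintro G' ⟨hnear, hfew⟩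
    set G'' := splice (touching (reach G {v, w} i)) G G' with hG''
    have hnearcard := card_near_distinguishing (d := d) (a := a) hnear
      (v := v) (w := w) (by rwa [reach_splice G G' hv le_rfl])
      (by rwa [reach_splice G G' hw le_rfl]) (by rwa [layer_splice])
    rw [reach_splice G G' le_rfl le_rfl] at hnearcard
    have hsub : O.filter (fun x => G' ∈ E x) ⊆
        distinguishing G'' v w \ reach G {v, w} (i + 1) := by
      intro x hx
      rw [Finset.mem_filter, hE] at hx
      have hxO := Finset.mem_compl.1 hx.1
      refine Finset.mem_sdiff.2 ⟨?_, hxO⟩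
      simp only [distinguishing, Finset.mem_filter, Finset.mem_univ, true_and]
      intro hd
      rw [SimpleGraph.dist_comm, SimpleGraph.dist_comm (u := x)] at hd
      refine hx.2 ?_
      rw [hA, hB, ← mem_reach_splice_succ G G' hv hxO, ← mem_reach_splice_succ G G' hw hxO,
        hnear.mem_reach_succ_iff, hnear.mem_reach_succ_iff, hd]
    have hsum := Finset.card_inter_add_card_sdiff (distinguishing G'' v w)
      (reach G {v, w} (i + 1))
    have hsum' : ((distinguishing G'' v w ∩ reach G {v, w} (i + 1)).card : ℝ) +
      (distinguishing G'' v w \ reach G {v, w} (i + 1)).card = (distinguishing G'' v w).card := by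
      exact_mod_cast hsum
    have hsub' : ((O.filter (fun x => G' ∈ E x)).card : ℝ) ≤
      (distinguishing G'' v w \ reach G {v, w} (i + 1)).card := by
      exact_mod_cast Finset.card_le_card hsub
    have hOq : (1 - b) * ((n - 2 * (1 + a) * d ^ i) * q) ≤ (1 - b) * (O.card * q) := by
      have : 0 ≤ 1 - b := by linarith
      gcongr
    show ((O.filter (fun x => G' ∈ E x)).card : ℝ) ≤ _
    linarith
  · refine Real.exp_le_exp.2 (neg_le_neg ?_)
    gcongr

/-! ### The lower bound -/

lemma card_reach_le_mul {n : ℕ} {G : SimpleGraph (Fin n)} {R : Finset (Fin n)} {j : ℕ} {M : ℝ}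
    (h : ∀ v, ((reach G {v} j).card : ℝ) ≤ M) : ((reach G R j).card : ℝ) ≤ R.card * M := by
  have h1 : reach G R j = R.biUnion fun v => reach G {v} j := by
    ext x
    rw [mem_reach_iff, Finset.mem_biUnion]
  have h2 : ((R.biUnion fun v => reach G {v} j).card : ℝ) ≤
      ∑ v ∈ R, ((reach G {v} j).card : ℝ) := by
    exact_mod_cast Finset.card_biUnion_le
  rw [h1, ← nsmul_eq_mul, ← Finset.sum_const]
  exact h2.trans (Finset.sum_le_sum fun v _ => h v)

/-- A lower bound of Bonferroni type on the size of a union of almost disjoint sets. -/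
lemma le_card_biUnion_of_card_inter_le {ι α : Type*} [DecidableEq ι] [DecidableEq α]
    (S : Finset ι) (B : ι → Finset α) {t o : ℝ} (ho : 0 ≤ o)
    (ht : ∀ u ∈ S, t ≤ ((B u).card : ℝ))
    (hB : ∀ u ∈ S, ∀ v ∈ S, u ≠ v → ((B u ∩ B v).card : ℝ) ≤ o) :
    S.card * t - S.card ^ 2 * o ≤ ((S.biUnion B).card : ℝ) := by
  induction S using Finset.induction_on with
  | empty => simp
  | insert x s hx ih =>
    have ih' := ih (fun u hu => ht u (Finset.mem_insert_of_mem hu))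
      fun u hu v hv => hB u (Finset.mem_insert_of_mem hu) v (Finset.mem_insert_of_mem hv)
    rw [Finset.biUnion_insert, Finset.card_insert_of_notMem hx]
    have h1 := Finset.card_union_add_card_inter (B x) (s.biUnion B)
    have h1' : ((B x ∪ s.biUnion B).card : ℝ) + (B x ∩ s.biUnion B).card =
      (B x).card + (s.biUnion B).card := by exact_mod_cast h1
    have h2 : ((B x ∩ s.biUnion B).card : ℝ) ≤ s.card * o := by
      rw [Finset.inter_biUnion, ← nsmul_eq_mul, ← Finset.sum_const]
      have h3 : ((s.biUnion fun v => B x ∩ B v).card : ℝ) ≤ ∑ v ∈ s, ((B x ∩ B v).card : ℝ) := by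
        exact_mod_cast Finset.card_biUnion_le
      refine h3.trans (Finset.sum_le_sum fun v hv => ?_)
      exact hB x (Finset.mem_insert_self _ _) v (Finset.mem_insert_of_mem hv)
        fun h => hx (h ▸ hv)
    have h4 := ht x (Finset.mem_insert_self _ _)
    have h5 : 0 ≤ (s.card : ℝ) * o := by positivity
    push_cast
    nlinarith

/-- Few vertices `u` of `R` have a substantial part of their `i`-ball within distance `i - 1`
of `R`. -/
lemma SphereGood.card_blocked_lt {n : ℕ} {G : SimpleGraph (Fin n)} {a d θ : ℝ} {i s : ℕ}
    (hG : SphereGood G a d i) (hi : 1 ≤ i) (hd : 0 < d) (ha : 0 ≤ a) (ha' : a ≤ 1)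
    (R : Finset (Fin n)) (has : 8 * a * s ≤ θ) (hs : 4 * R.card < s * θ * d) :
    (R.filter fun u => θ * d ^ i < ((reach G {u} (i + 1) ∩ reach G R i).card : ℝ)).card < s := by
  by_contra hcon
  obtain ⟨S, hS, hScard⟩ := Finset.exists_subset_card_eq (not_lt.1 hcon)
  have hd' : 0 < d ^ i := by positivity
  have h1 := le_card_biUnion_of_card_inter_le S
    (fun u => reach G {u} (i + 1) ∩ reach G R i) (t := θ * d ^ i) (o := 4 * a * d ^ i)
    (by positivity) (fun u hu => (Finset.mem_filter.1 (hS hu)).2.le) (by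
      intro u _ v _ huv
      have h2 : ((reach G {u} (i + 1) ∩ reach G R i) ∩ (reach G {v} (i + 1) ∩ reach G R i)).card ≤
          (reach G {u} (i + 1) ∩ reach G {v} (i + 1)).card :=
        Finset.card_le_card (Finset.inter_subset_inter Finset.inter_subset_left
          Finset.inter_subset_left)
      have h3 := Finset.card_union_add_card_inter (reach G {u} (i + 1)) (reach G {v} (i + 1))
      have h4 : (layer G {u, v} i).card ≤ (reach G {u} (i + 1) ∪ reach G {v} (i + 1)).card := by
        refine Finset.card_le_card (Finset.sdiff_subset.trans fun x hx => ?_)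
        simpa [mem_reach_iff (R := {u, v})] using hx
      have h2' : (((reach G {u} (i + 1) ∩ reach G R i) ∩
        (reach G {v} (i + 1) ∩ reach G R i)).card : ℝ) ≤
          (reach G {u} (i + 1) ∩ reach G {v} (i + 1)).card := by exact_mod_cast h2
      have h3' : ((reach G {u} (i + 1) ∪ reach G {v} (i + 1)).card : ℝ) +
        (reach G {u} (i + 1) ∩ reach G {v} (i + 1)).card =
          (reach G {u} (i + 1)).card + (reach G {v} (i + 1)).card := by exact_mod_cast h3
      have h4' : ((layer G {u, v} i).card : ℝ) ≤
        (reach G {u} (i + 1) ∪ reach G {v} (i + 1)).card := by exact_mod_cast h4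
      have h5 := hG.2 u v huv
      have h6 := (hG.1 u).1
      have h7 := (hG.1 v).1
      linarith)
  have h2 : ((S.biUnion fun u => reach G {u} (i + 1) ∩ reach G R i).card : ℝ) ≤
      R.card * ((1 + a) * d ^ (i - 1)) := by
    refine le_trans ?_ (card_reach_le_mul fun v => (hG.1 v).2.1)
    rw [Nat.cast_le]
    exact Finset.card_le_card (Finset.biUnion_subset.2 fun u _ => Finset.inter_subset_right)
  rw [hScard] at h1
  obtain ⟨k, rfl⟩ : ∃ k, i = k + 1 := ⟨i - 1, by omega⟩
  rw [Nat.add_sub_cancel] at h2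
  have hdk : 0 < d ^ k := by positivity
  have h3 : (s : ℝ) * (θ / 2) * d ^ (k + 1) ≤ s * (θ * d ^ (k + 1)) -
      s ^ 2 * (4 * a * d ^ (k + 1)) := by
    have h4 : (s : ℝ) * d ^ (k + 1) * (8 * a * s) ≤ s * d ^ (k + 1) * θ := by gcongr
    linarith
  have h4 : (R.card : ℝ) * ((1 + a) * d ^ k) ≤ R.card * (2 * d ^ k) := by
    gcongr
    linarith
  have h5 : (s * θ * d / 2) * d ^ k ≤ (2 * R.card) * d ^ k := by
    rw [pow_succ] at h3
    rw [pow_succ] at h1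
    linarith
  have := le_of_mul_le_mul_right h5 hdk
  linarith

/-- Many vertices are at distance more than `j + 1` from `R`. -/
lemma gnpProb_few_outside {n : ℕ} {p K q : ℝ} (hp : 0 ≤ p) (hp' : p ≤ 1) (hq0 : 0 ≤ q)
    (hK : 2 * K ≤ n) (hq : ∀ k : ℕ, (k : ℝ) ≤ K → q ≤ (1 - p) ^ k) (R : Finset (Fin n)) (j : ℕ) :
    gnpProb n p ({G | ((reach G R (j + 1)).card : ℝ) ≤ K} ∩
      {G | ((reach G R (j + 2))ᶜ.card : ℝ) ≤ n * q / 4}) ≤ Real.exp (-(n * q / 32)) := by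
  refine gnpProb_inter_le_of_expose hp hp' (by positivity) R j ?_ ?_
  · intro G G' h
    simpa only [Set.mem_ofPred_eq, reach_splice G G' le_rfl (le_refl (j + 1))] using h
  intro G h1
  rw [Set.mem_ofPred_eq] at h1
  set L := layer G R j with hL
  set O := (reach G R (j + 1))ᶜ with hO
  have hOL : Disjoint O L := by
    rw [Finset.disjoint_left]
    intro x hx hx'
    exact (Finset.mem_compl.1 hx) (Finset.mem_sdiff.1 hx').1
  have hOcard : (n : ℝ) / 2 ≤ O.card := by
    have := card_compl_reach_ge h1
    linarith
  have hLcard : (L.card : ℝ) ≤ K :=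
    le_trans (by exact_mod_cast Finset.card_le_card Finset.sdiff_subset) h1
  obtain ⟨A, hA⟩ : ∃ A : Fin n → Set (SimpleGraph (Fin n)),
      A = fun x => {G' | ∀ z ∈ L, ¬ G'.Adj x z} := ⟨_, rfl⟩
  have hdep : ∀ x ∈ O, DependsOnRow L x (fun G' => G' ∈ A x) := by
    intro x _ G₁ G₂ h
    simp only [hA, Set.mem_ofPred_eq, eq_iff_iff]
    exact forall₂_congr fun z hz => not_congr (h z hz)
  have hprob : ∀ x ∈ O, q ≤ gnpProb n p (A x) := by
    intro x hx
    rw [hA, gnpProb_no_nbr x L (Finset.disjoint_left.1 hOL hx)]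
    exact hq _ hLcard
  have hOq : (n : ℝ) * q / 2 ≤ O.card * q := by
    have := mul_le_mul_of_nonneg_right hOcard hq0
    linarith
  refine (gnpProb_mono hp hp' ?_).trans ((gnpProb_count_le hp hp' hOL A hdep (b := 1 / 2)
    (by norm_num) (by norm_num) hprob hq0).trans ?_)
  · intro G' hG'
    rw [Set.mem_ofPred_eq, Set.mem_ofPred_eq] at hG'
    rw [Set.mem_ofPred_eq]
    have hsub : O.filter (fun x => G' ∈ A x) ⊆
        (reach (splice (touching (reach G R j)) G G') R (j + 2))ᶜ := by
      intro x hx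
      rw [Finset.mem_filter, hA] at hx
      rw [Finset.mem_compl, mem_reach_splice_succ G G' le_rfl (Finset.mem_compl.1 hx.1)]
      rintro ⟨z, hz, hxz⟩
      exact hx.2 z hz hxz
    have hsub' : ((O.filter (fun x => G' ∈ A x)).card : ℝ) ≤
        (reach (splice (touching (reach G R j)) G G') R (j + 2))ᶜ.card := by
      exact_mod_cast Finset.card_le_card hsub
    linarith
  · refine Real.exp_le_exp.2 ?_
    linarith

/-- If many vertices outside the `i`-ball around `R` see all vertices of `R` but a few at distance
`i + 1`, then `R` is unlikely to be resolving. -/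
lemma gnpProb_resolves_of_outside {n : ℕ} {p τ w q f : ℝ} (hp : 0 ≤ p) (hp' : p ≤ 1)
    (hq0 : 0 ≤ q) (hf : (2 : ℝ) ^ f ≤ w * q / 2) (R : Finset (Fin n)) (i : ℕ) :
    gnpProb n p ({G | w ≤ ((reach G R (i + 1))ᶜ.card : ℝ) ∧
        ((R.filter fun u => ((reach G {u} (i + 1) \ reach G R i).card : ℝ) < τ).card : ℝ) ≤ f ∧
        q ≤ ∏ u ∈ R.filter fun u => ¬ ((reach G {u} (i + 1) \ reach G R i).card : ℝ) < τ,
          (1 - (1 - p) ^ (reach G {u} (i + 1) \ reach G R i).card)} ∩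
      {G | NearAll G i ∧ Resolves G (R : Set (Fin n))}) ≤ Real.exp (-(w * q / 16)) := by
  have hu : ∀ {u}, u ∈ R → ({u} : Finset (Fin n)) ⊆ R := fun h => Finset.singleton_subset_iff.2 h
  refine gnpProb_inter_le_of_expose hp hp' (by positivity) R i ?_ ?_
  · intro G G' h
    have e : ∀ u ∈ R, reach (splice (touching (reach G R i)) G G') {u} (i + 1) \
        reach (splice (touching (reach G R i)) G G') R i =
        reach G {u} (i + 1) \ reach G R i := fun u h => by
      rw [reach_splice G G' (hu h) le_rfl, reach_splice G G' le_rfl (Nat.le_succ i)]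
    obtain ⟨h1, h2, h3⟩ := h
    refine ⟨by rwa [reach_splice G G' le_rfl le_rfl] at h1, ?_, ?_⟩
    · rwa [Finset.filter_congr fun u hu => by rw [e u hu]] at h2
    · refine h3.trans (le_of_eq ?_)
      rw [Finset.filter_congr fun u hu => by rw [e u hu]]
      exact Finset.prod_congr rfl fun u hu => by rw [e u (Finset.mem_filter.1 hu).1]
  rintro G ⟨h1, h2, h3⟩
  set T : Fin n → Finset (Fin n) := fun u => reach G {u} (i + 1) \ reach G R i with hT
  set F := R.filter fun u => ((T u).card : ℝ) < τ with hF
  set N := R.filter fun u => ¬ ((T u).card : ℝ) < τ with hN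
  set W := (reach G R (i + 1))ᶜ with hW
  have hTsub : ∀ u ∈ R, T u ⊆ layer G R i := fun u h =>
    Finset.sdiff_subset_sdiff (reach_mono_left G (hu h) _) le_rfl
  have hWL : Disjoint W (layer G R i) := by
    rw [Finset.disjoint_left]
    intro x hx hx'
    exact (Finset.mem_compl.1 hx) (Finset.mem_sdiff.1 hx').1
  obtain ⟨A, hA⟩ : ∃ A : Fin n → Set (SimpleGraph (Fin n)),
      A = fun x => {G' | ∀ u ∈ N, G' ∈ {G' : SimpleGraph (Fin n) | ∃ z ∈ T u, G'.Adj x z}} :=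
    ⟨_, rfl⟩
  have hdep : ∀ x ∈ W, DependsOnRow (layer G R i) x (fun G' => G' ∈ A x) := by
    intro x _ G₁ G₂ h
    simp only [hA, Set.mem_ofPred_eq, eq_iff_iff]
    refine forall₂_congr fun u hu => ?_
    exact iff_of_eq (dependsOnRow_exists (hTsub u (Finset.mem_filter.1 hu).1) x G₁ G₂ h)
  have hprob : ∀ x ∈ W, q ≤ gnpProb n p (A x) := by
    intro x hx
    rw [hA]
    refine h3.trans (le_trans (le_of_eq ?_) (prod_gnpProb_le_of_isUpperSet hp hp' N
      (fun u => {G' : SimpleGraph (Fin n) | ∃ z ∈ T u, G'.Adj x z})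
      fun u => isUpperSet_exists_nbr x (T u)))
    refine Finset.prod_congr rfl fun u hu => ?_
    rw [gnpProb_exists_nbr x (T u) fun h => Finset.disjoint_left.1 hWL hx
      (hTsub u (Finset.mem_filter.1 hu).1 h)]
  have hWq : w * q ≤ W.card * q := mul_le_mul_of_nonneg_right h1 hq0
  refine (gnpProb_mono hp hp' ?_).trans ((gnpProb_count_le hp hp' hWL A hdep (b := 1 / 2)
    (by norm_num) (by norm_num) hprob hq0).trans ?_)
  · rintro G' ⟨hnear, hres⟩
    set G'' := splice (touching (reach G R i)) G G' with hG''
    rw [Set.mem_ofPred_eq]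
    by_contra hcon
    set Y := W.filter fun x => G' ∈ A x with hY
    have hlt : F.powerset.card < Y.card := by
      rw [Finset.card_powerset]
      have h4 : ((2 ^ F.card : ℕ) : ℝ) ≤ 2 ^ f := by
        rw [Nat.cast_pow, Nat.cast_ofNat, ← Real.rpow_natCast]
        exact Real.rpow_le_rpow_of_exponent_le one_le_two h2
      have h5 : ((2 ^ F.card : ℕ) : ℝ) < Y.card := by linarith
      exact_mod_cast h5
    obtain ⟨x, hx, y, hy, hxy, heq⟩ := Finset.exists_ne_map_eq_of_card_lt_of_maps_to hlt
      (f := fun x => F.filter fun u => x ∈ reach G'' {u} (i + 2))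
      (fun x _ => Finset.mem_powerset.2 (Finset.filter_subset _ _))
    obtain ⟨u, huR, hdist⟩ := hres hxy
    refine hdist ?_
    have hnot : ∀ z ∈ Y, ¬ G''.dist u z ≤ i := by
      intro z hz hle
      refine Finset.mem_compl.1 (Finset.mem_filter.1 hz).1 ?_
      rw [← reach_splice G G' le_rfl le_rfl, mem_reach_iff]
      exact ⟨u, huR, hnear.mem_reach_succ_iff.2 hle⟩
    have hiff : G''.dist u x ≤ i + 1 ↔ G''.dist u y ≤ i + 1 := by
      by_cases huF : u ∈ F
      · have h4 := congrArg (u ∈ ·) heq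
        simp only [Finset.mem_filter, huF, true_and, eq_iff_iff] at h4
        rwa [hnear.mem_reach_succ_iff, hnear.mem_reach_succ_iff] at h4
      · have huN : u ∈ N := by
          simp only [hF, hN, Finset.mem_filter, not_and] at huF ⊢
          exact ⟨huR, huF huR⟩
        have hall : ∀ z ∈ Y, G''.dist u z ≤ i + 1 := by
          intro z hz
          obtain ⟨hz1, hz2⟩ := Finset.mem_filter.1 hz
          rw [hA] at hz2
          rw [← hnear.mem_reach_succ_iff,
            mem_reach_splice_succ G G' (hu huR) (Finset.mem_compl.1 hz1)]
          exact hz2 u huN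
        exact iff_of_true (hall x hx) (hall y hy)
    have := hnot x hx
    have := hnot y hy
    have := hnear.dist_le u x
    have := hnear.dist_le u y
    omega
  · refine Real.exp_le_exp.2 ?_
    linarith

lemma exp_neg_le_one_sub {x : ℝ} (hx' : x ≤ 1 / 2) :
    Real.exp (-(x + 2 * x ^ 2)) ≤ 1 - x := by
  rw [Real.exp_neg, inv_le_comm₀ (Real.exp_pos _) (by linarith)]
  refine le_trans ?_ (Real.add_one_le_exp _)
  rw [inv_le_iff_one_le_mul₀ (by linarith)]
  nlinarith [mul_nonneg (sq_nonneg x) (by linarith : 0 ≤ 1 - 2 * x)]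

lemma exp_neg_two_mul_le_one_sub {x : ℝ} (hx : 0 ≤ x) (hx' : x ≤ 1 / 2) :
    Real.exp (-(2 * x)) ≤ 1 - x := by
  refine le_trans (Real.exp_le_exp.2 ?_) (exp_neg_le_one_sub hx')
  nlinarith

lemma one_sub_pow_le_of_le {p t e : ℝ} (hp : 0 ≤ p) (hp' : p ≤ 1) {k : ℕ} (hk : t ≤ k)
    (he : Real.exp (-(p * t)) ≤ e) : (1 - p) ^ k ≤ e := by
  refine (one_sub_pow_le_exp hp' k).trans (le_trans (Real.exp_le_exp.2 ?_) he)
  have := mul_le_mul_of_nonneg_left hk hp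
  linarith

lemma SphereGood.le_card_sdiff {n : ℕ} {G : SimpleGraph (Fin n)} {a d θ : ℝ} {i : ℕ}
    (hG : SphereGood G a d i) {R : Finset (Fin n)} {u : Fin n}
    (hu : ¬ θ * d ^ i < ((reach G {u} (i + 1) ∩ reach G R i).card : ℝ)) :
    (1 - a - θ) * d ^ i ≤ ((reach G {u} (i + 1) \ reach G R i).card : ℝ) := by
  have h1 := Finset.card_inter_add_card_sdiff (reach G {u} (i + 1)) (reach G R i)
  have h1' : ((reach G {u} (i + 1) ∩ reach G R i).card : ℝ) +
    (reach G {u} (i + 1) \ reach G R i).card = (reach G {u} (i + 1)).card := by exact_mod_cast h1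
  have h2 : ((layer G {u} i).card : ℝ) ≤ (reach G {u} (i + 1)).card := by
    exact_mod_cast Finset.card_le_card Finset.sdiff_subset
  have := (hG.1 u).2.2
  linarith

lemma SphereGood.exp_le_prod {n : ℕ} {G : SimpleGraph (Fin n)} {p a d θ e₁ e₂ : ℝ} {i s : ℕ}
    (hp : 0 ≤ p) (hp' : p ≤ 1)
    (hG : SphereGood G a d i) (hi : 1 ≤ i) (hd : 0 < d) (ha : 0 ≤ a) (ha' : a ≤ 1 / 4)
    (R : Finset (Fin n)) (has : 8 * a * s ≤ θ) (hs : 4 * R.card < s * θ * d)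
    (he₁ : Real.exp (-(p * (d ^ i / 2))) ≤ e₁) (he₁' : e₁ ≤ 1 / 2)
    (he₂ : Real.exp (-(p * ((1 - a - θ) * d ^ i))) ≤ e₂) (he₂' : e₂ ≤ 1 / 2) :
    Real.exp (-(s * (2 * e₁) + R.card * (e₂ + 2 * e₂ ^ 2))) ≤
      ∏ u ∈ R.filter fun u => ¬ ((reach G {u} (i + 1) \ reach G R i).card : ℝ) <
          (1 - a - 1 / 4) * d ^ i,
        (1 - (1 - p) ^ (reach G {u} (i + 1) \ reach G R i).card) := by
  set N := R.filter fun u => ¬ ((reach G {u} (i + 1) \ reach G R i).card : ℝ) <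
          (1 - a - 1 / 4) * d ^ i with hN
  set M := R.filter fun u => θ * d ^ i < ((reach G {u} (i + 1) ∩ reach G R i).card : ℝ) with hM
  have hMs : M.card < s := hG.card_blocked_lt hi hd ha (by linarith) R has hs
  have he₁0 : 0 < e₁ := (Real.exp_pos _).trans_le he₁
  have he₂0 : 0 < e₂ := (Real.exp_pos _).trans_le he₂
  have hd' : 0 < d ^ i := by positivity
  have hp1 : 0 ≤ 1 - p := by linarith
  have hterm : ∀ u ∈ N, Real.exp (-(if u ∈ M then 2 * e₁ else e₂ + 2 * e₂ ^ 2)) ≤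
      1 - (1 - p) ^ (reach G {u} (i + 1) \ reach G R i).card := by
    intro u hu
    obtain ⟨huR, hu⟩ := Finset.mem_filter.1 hu
    split_ifs with huM
    · have h1 : (1 - p) ^ (reach G {u} (i + 1) \ reach G R i).card ≤ e₁ := by
        refine one_sub_pow_le_of_le hp hp' (le_trans ?_ (not_lt.1 hu)) he₁
        nlinarith
      refine (exp_neg_two_mul_le_one_sub he₁0.le he₁').trans ?_
      linarith
    · have h1 : (1 - p) ^ (reach G {u} (i + 1) \ reach G R i).card ≤ e₂ :=
        one_sub_pow_le_of_le hp hp' (hG.le_card_sdiff fun h =>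
          huM (Finset.mem_filter.2 ⟨huR, h⟩)) he₂
      refine (exp_neg_le_one_sub he₂').trans ?_
      linarith
  refine le_trans ?_ (Finset.prod_le_prod (fun u _ => (Real.exp_pos _).le) hterm)
  rw [← Real.exp_sum, Real.exp_le_exp, Finset.sum_neg_distrib, neg_le_neg_iff]
  have h1 : ∑ u ∈ N, (if u ∈ M then 2 * e₁ else e₂ + 2 * e₂ ^ 2) ≤
      ∑ u ∈ R, ((if u ∈ M then 2 * e₁ else 0) + (e₂ + 2 * e₂ ^ 2)) := by
    refine (Finset.sum_le_sum fun u _ => ?_).trans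
      (Finset.sum_le_sum_of_subset_of_nonneg (Finset.filter_subset _ _) fun u _ _ => ?_)
    · split_ifs
      · have : 0 ≤ e₂ + 2 * e₂ ^ 2 := by positivity
        linarith
      · linarith
    · split_ifs <;> positivity
  refine h1.trans ?_
  rw [Finset.sum_add_distrib, Finset.sum_const, nsmul_eq_mul, ← Finset.sum_filter, Finset.sum_const,
    nsmul_eq_mul]
  have h2 : ((R.filter (· ∈ M)).card : ℝ) ≤ s := by
    have : R.filter (· ∈ M) ⊆ M := fun u hu => (Finset.mem_filter.1 hu).2
    exact_mod_cast (Finset.card_le_card this).trans hMs.le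
  gcongr

/-- A given set of moderate size is very unlikely to be resolving. -/
lemma gnpProb_resolves_le {n : ℕ} {p a d θ e₁ e₂ K q q' : ℝ} {i s t : ℕ}
    (hp : 0 ≤ p) (hp' : p ≤ 1) (hi : 1 ≤ i) (hd : 0 < d) (ha : 0 ≤ a) (ha' : a ≤ 1 / 4)
    (R : Finset (Fin n)) (hq0 : 0 ≤ q) (hRK : R.card * ((1 + a) * d ^ (i - 1)) ≤ K)
    (hK : 2 * K ≤ n) (hq : ∀ k : ℕ, (k : ℝ) ≤ K → q ≤ (1 - p) ^ k)
    (hat : 8 * a * t ≤ 1 / 4) (ht : 4 * R.card < t * (1 / 4) * d)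
    (has : 8 * a * s ≤ θ) (hs : 4 * R.card < s * θ * d)
    (he₁ : Real.exp (-(p * (d ^ i / 2))) ≤ e₁) (he₁' : e₁ ≤ 1 / 2)
    (he₂ : Real.exp (-(p * ((1 - a - θ) * d ^ i))) ≤ e₂) (he₂' : e₂ ≤ 1 / 2)
    (hq' : q' = Real.exp (-(s * (2 * e₁) + R.card * (e₂ + 2 * e₂ ^ 2))))
    (hmany : (2 : ℝ) ^ (t : ℝ) ≤ n * q / 4 * q' / 2) :
    gnpProb n p {G | SphereGood G a d i ∧ NearAll G i ∧ Resolves G (R : Set (Fin n))} ≤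
      Real.exp (-(n * q / 32)) + Real.exp (-(n * q / 4 * q' / 16)) := by
  obtain ⟨j, rfl⟩ : ∃ j, i = j + 1 := ⟨i - 1, by omega⟩
  have hd' : 0 < d ^ (j + 1) := by positivity
  have hq'0 : 0 ≤ q' := hq' ▸ (Real.exp_pos _).le
  refine gnpProb_le_add hp hp' ?_ (gnpProb_few_outside hp hp' hq0 hK hq R j)
    (gnpProb_resolves_of_outside (τ := (1 - a - 1 / 4) * d ^ (j + 1)) hp hp' hq'0 hmany R (j + 1))
  rintro G ⟨hG, hnear, hres⟩
  have hreach : ((reach G R (j + 1)).card : ℝ) ≤ K :=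
    (card_reach_le_mul fun v => (hG.1 v).2.1).trans hRK
  by_cases hfew : ((reach G R (j + 2))ᶜ.card : ℝ) ≤ n * q / 4
  · exact Or.inl ⟨hreach, hfew⟩
  refine Or.inr ⟨⟨(not_le.1 hfew).le, ?_, ?_⟩, hnear, hres⟩
  · have h1 := hG.card_blocked_lt hi hd ha (by linarith) R hat ht
    refine le_trans (Nat.cast_le.2 (Finset.card_le_card ?_)) (Nat.cast_le.2 h1.le)
    intro u hu
    rw [Finset.mem_filter] at hu ⊢
    refine ⟨hu.1, ?_⟩
    by_contra hcon
    exact (hG.le_card_sdiff hcon).not_gt hu.2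
  · rw [hq']
    exact hG.exp_le_prod hp hp' hi hd ha ha' R has hs he₁ he₁' he₂ he₂'

lemma NearAll.exists_resolves {n m i : ℕ} {G : SimpleGraph (Fin n)} (hG : NearAll G i)
    (h : metricDim G ≤ m) (hm : m ≤ n) :
    ∃ R : Finset (Fin n), R.card = m ∧ Resolves G (R : Set (Fin n)) := by
  have hne : {k : ℕ | ∃ R : Set (Fin n), R.Finite ∧ R.ncard = k ∧ Resolves G R}.Nonempty := by
    refine ⟨_, Set.univ, Set.finite_univ, rfl, fun v w hvw => ⟨v, Set.mem_univ v, ?_⟩⟩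
    rw [SimpleGraph.dist_self]
    exact ((hG.reachable v w).pos_dist_of_ne hvw).ne
  obtain ⟨R, hfin, hcard, hres⟩ := Nat.sInf_mem hne
  have hR : hfin.toFinset.card ≤ m := by
    rw [← Set.ncard_eq_toFinset_card R hfin, hcard]
    exact h
  obtain ⟨T, hT, hTm⟩ := Finset.exists_superset_card_eq hR (by simpa using hm)
  refine ⟨T, hTm, fun v w hvw => ?_⟩
  obtain ⟨u, hu, hd⟩ := hres hvw
  exact ⟨u, hT (hfin.mem_toFinset.2 hu), hd⟩

lemma gnpProb_metricDim_le {n m i : ℕ} {p a d q : ℝ} (hp : 0 ≤ p) (hp' : p ≤ 1) (hm : m ≤ n)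
    (hq0 : 0 ≤ q) (hq : ∀ R : Finset (Fin n), R.card = m →
      gnpProb n p {G | SphereGood G a d i ∧ NearAll G i ∧ Resolves G (R : Set (Fin n))} ≤ q) :
    gnpProb n p {G | SphereGood G a d i ∧ NearAll G i ∧ metricDim G ≤ m} ≤ n ^ m * q := by
  refine (gnpProb_mono hp hp' ?_).trans ((gnpProb_biUnion_le hp hp'
    ((Finset.univ : Finset (Fin n)).powersetCard m) _ fun R hR =>
      hq R (Finset.mem_powersetCard.1 hR).2).trans ?_)
  · rintro G ⟨h1, h2, h3⟩
    obtain ⟨R, hR, hres⟩ := h2.exists_resolves h3 hm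
    exact ⟨R, Finset.mem_powersetCard.2 ⟨Finset.subset_univ _, hR⟩, h1, h2, hres⟩
  · rw [Finset.card_powersetCard, Finset.card_univ, Fintype.card_fin]
    gcongr
    exact_mod_cast Nat.choose_le_pow n m

lemma exp_neg_mul_le_one_sub_pow {p K : ℝ} (hp : 0 ≤ p) (hp' : p ≤ 1 / 2) {k : ℕ}
    (hk : (k : ℝ) ≤ K) : Real.exp (-((p + 2 * p ^ 2) * K)) ≤ (1 - p) ^ k := by
  refine le_trans ?_ (pow_le_pow_left₀ (Real.exp_pos _).le (exp_neg_le_one_sub hp') k)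
  rw [← Real.exp_nat_mul, Real.exp_le_exp]
  have : (p + 2 * p ^ 2) * k ≤ (p + 2 * p ^ 2) * K := by gcongr
  linarith

lemma one_add_pow_three_le {y : ℝ} (hy : 0 ≤ y) (hy' : y ≤ 1) : (1 + y) ^ 3 ≤ 1 + 7 * y := by
  nlinarith [mul_nonneg hy (by linarith : 0 ≤ 1 - y), mul_nonneg (mul_nonneg hy hy)
    (by linarith : 0 ≤ 1 - y)]

lemma le_mul_pow_of_eq {n i : ℕ} {p d c : ℝ} (hn : 2 ≤ n) (hd : d = p * ((n : ℝ) - 1))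
    (hc : c = d ^ (i + 1) / n) (hc0 : 0 ≤ c) :
    p * d ^ i * ((n : ℝ) - 1) = c * n ∧ c ≤ p * d ^ i := by
  have hn' : (2 : ℝ) ≤ n := by exact_mod_cast hn
  have hn0 : (n : ℝ) ≠ 0 := by linarith
  have h : p * d ^ i * ((n : ℝ) - 1) = c * n := by
    rw [hc, div_mul_cancel₀ _ hn0, pow_succ, hd]
    ring
  refine ⟨h, ?_⟩
  have : c * ((n : ℝ) - 1) ≤ p * d ^ i * ((n : ℝ) - 1) := by
    rw [h]
    exact mul_le_mul_of_nonneg_left (by linarith) hc0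
  exact le_of_mul_le_mul_right this (by linarith)

set_option maxHeartbeats 1000000 in
/-- The probability that the metric dimension is small, in terms of explicit parameters. -/
lemma gnpProb_metricDim_lt {n i : ℕ} {p d c a θ σ δ L η : ℝ} (hp : 0 ≤ p) (hp' : p ≤ 1)
    (hi : 1 ≤ i) (hn : 2 ≤ n) (hL : L = Real.log n) (hL1 : 1 ≤ L) (hd : d = p * ((n : ℝ) - 1))
    (hc : c = d ^ (i + 1) / n) (hη : η = Real.log (d ^ i) / Real.log n) (hdL : 16 * L ≤ d)
    (hdn : d ^ i ≤ n) (hσ : 0 < σ) (hσδ : 22 * σ ≤ δ) (hpσ : 2 * p ≤ σ / 7)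
    (haσ : a ≤ σ / 7) (hnσ : 1 ≤ σ / 7 * ((n : ℝ) - 1)) (ha : 0 ≤ a) (hθ : 0 < θ)
    (haθ : a + θ ≤ 1 / 2) (hc2 : 2 ≤ c) (hat : 8 * a * (16 * L / c + 1) ≤ 1 / 4)
    (has : 8 * a * (4 * L / (c * θ) + 1) ≤ θ)
    (he₁ : (4 * L / (c * θ) + 1) * (2 * Real.exp (-(c / 2))) ≤ σ * L)
    (he₂ : ∀ m : ℕ, m ≤ n → m * Real.exp (-c) ≤ L → m * (Real.exp (-(c * (1 - a - θ))) +
      2 * Real.exp (-(c * (1 - a - θ))) ^ 2) ≤ m * Real.exp (-c) + 9 * σ * L)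
    (hmany : 16 * L / c + 1 + Real.log 8 ≤ δ / 2 * L)
    (hbig : 64 * (L ^ 2 + L) ≤ Real.exp (δ / 2 * L)) :
    gnpProb n p {G | SphereGood G a d i ∧ NearAll G i ∧
      (metricDim G : ℝ) < (η - δ) * ((d ^ i / n + Real.exp (-c))⁻¹ * L)} ≤
      2 * Real.exp (-L) := by
  have hn0 : (0 : ℝ) < n := by
    have : (2 : ℝ) ≤ n := by exact_mod_cast hn
    linarith
  have hn1 : (0 : ℝ) < (n : ℝ) - 1 := by
    have : (2 : ℝ) ≤ n := by exact_mod_cast hn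
    linarith
  have hd0 : 0 < d := by linarith
  have hd1 : 1 ≤ d := by linarith
  have hD0 : 0 < d ^ i := by positivity
  have hexpL : Real.exp L = n := by rw [hL, Real.exp_log hn0]
  have hexpη : Real.exp (L * η) = d ^ i := by
    rw [hη, ← hL, mul_div_cancel₀ _ (by linarith), Real.exp_log hD0]
  have hη1 : η ≤ 1 := by
    rw [hη, ← hL, div_le_one (by linarith), hL]
    exact Real.log_le_log hD0 hdn
  set ρ := d ^ i / n + Real.exp (-c) with hρ
  have hρ0 : 0 < ρ := by positivity
  rcases le_or_gt (η - δ) 0 with hneg | hpos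
  · refine le_trans (le_of_eq ?_) (by positivity)
    rw [← gnpProb_empty n p]
    congr 1
    ext G
    simp only [Set.mem_ofPred_eq, Set.mem_empty_iff_false, iff_false]
    rintro ⟨-, -, h⟩
    have h1 : (η - δ) * (ρ⁻¹ * L) ≤ 0 :=
      mul_nonpos_of_nonpos_of_nonneg hneg (by positivity)
    have h2 : (0 : ℝ) ≤ metricDim G := Nat.cast_nonneg _
    linarith
  set m := ⌊(η - δ) * (ρ⁻¹ * L)⌋₊ with hm
  have hmρ : m * ρ ≤ (η - δ) * L := by
    have h1 : (m : ℝ) ≤ (η - δ) * (ρ⁻¹ * L) := Nat.floor_le (by positivity)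
    calc m * ρ ≤ (η - δ) * (ρ⁻¹ * L) * ρ := by gcongr
      _ = (η - δ) * L := by field_simp
  have hδ0 : 0 < δ := by linarith
  have hηδL : (η - δ) * L ≤ L := mul_le_of_le_one_left (by linarith) (by linarith)
  have hm0 : (0 : ℝ) ≤ m := Nat.cast_nonneg m
  have hmD : m * (d ^ i / n) ≤ L := by
    have : 0 ≤ m * Real.exp (-c) := by positivity
    rw [hρ, mul_add] at hmρ
    linarith
  have hme : m * Real.exp (-c) ≤ L := by
    have : 0 ≤ m * (d ^ i / n) := by positivity
    rw [hρ, mul_add] at hmρ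
    linarith
  have hmD' : m * d ^ i ≤ L * n := by
    rw [← mul_div_assoc, div_le_iff₀ hn0] at hmD
    exact hmD
  have hLD : L ≤ d ^ i := by
    have := pow_le_pow_right₀ hd1 hi
    rw [pow_one] at this
    linarith
  have hmn : m ≤ n := by
    have : (m : ℝ) * d ^ i ≤ n * d ^ i := by
      rw [mul_comm (n : ℝ)]
      exact hmD'.trans (mul_le_mul_of_nonneg_right hLD hn0.le)
    exact_mod_cast le_of_mul_le_mul_right this hD0
  have hc0 : 0 < c := by linarith
  have hmd : m / d ≤ L / c := by
    rw [div_le_div_iff₀ hd0 hc0, hc, ← mul_div_assoc, div_le_iff₀ hn0, pow_succ, ← mul_assoc,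
      mul_right_comm L]
    exact mul_le_mul_of_nonneg_right hmD' hd0.le
  have hpc := (le_mul_pow_of_eq hn hd hc hc0.le).2
  have hx0 : 0 ≤ 16 * L / c := by positivity
  have hx1 : 0 ≤ 4 * L / (c * θ) := by positivity
  set t := ⌊16 * L / c⌋₊ + 1 with ht
  set s := ⌊4 * L / (c * θ)⌋₊ + 1 with hs
  have ht1 : (t : ℝ) ≤ 16 * L / c + 1 := by
    rw [ht]
    push_cast
    linarith [Nat.floor_le hx0]
  have ht2 : 16 * L / c < t := by
    rw [ht]
    exact_mod_cast Nat.lt_floor_add_one _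
  have hs1 : (s : ℝ) ≤ 4 * L / (c * θ) + 1 := by
    rw [hs]
    push_cast
    linarith [Nat.floor_le hx1]
  have hs2 : 4 * L / (c * θ) < s := by
    rw [hs]
    exact_mod_cast Nat.lt_floor_add_one _
  set K := m * ((1 + a) * d ^ (i - 1)) with hK
  set q := Real.exp (-((p + 2 * p ^ 2) * K)) with hq
  set e₂ := Real.exp (-(c * (1 - a - θ))) with he₂def
  set q' := Real.exp (-(s * (2 * Real.exp (-(c / 2))) + m * (e₂ + 2 * e₂ ^ 2))) with hq'
  have hdi : d ^ (i - 1) * d = d ^ i := by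
    rw [← pow_succ]
    congr 1
    omega
  have hdi0 : 0 < d ^ (i - 1) := by positivity
  have hK0 : 0 ≤ K := by positivity
  have hKn : 2 * K ≤ n := by
    have h1 : m * d ^ (i - 1) * (16 * L) ≤ L * n := by
      calc m * d ^ (i - 1) * (16 * L) ≤ m * d ^ (i - 1) * d := by gcongr
        _ = m * d ^ i := by rw [mul_assoc, hdi]
        _ ≤ L * n := hmD'
    have h2 : (m * d ^ (i - 1) * 16) * L ≤ n * L := by linarith
    have h3 := le_of_mul_le_mul_right h2 (by linarith)
    have h4 : K ≤ 2 * (m * d ^ (i - 1)) := by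
      rw [hK]
      have : 0 ≤ m * d ^ (i - 1) := by positivity
      have := mul_le_mul_of_nonneg_right (by linarith : 1 + a ≤ 2) this
      linarith
    linarith
  have hhalf : ∀ x : ℝ, 1 ≤ x → Real.exp (-x) ≤ 1 / 2 := by
    intro x hx
    have h1 : Real.exp (-x) ≤ Real.exp (-1) := Real.exp_le_exp.2 (by linarith)
    linarith [Real.exp_neg_one_lt_half]
  have hKexp : (p + 2 * p ^ 2) * K ≤ m * (d ^ i / n) + σ * L := by
    have h1 : p * d ^ (i - 1) ≤ (1 + σ / 7) * (d ^ i / n) := by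
      rw [← mul_div_assoc, le_div_iff₀ hn0]
      have h2 : p * d ^ (i - 1) * ((n : ℝ) - 1) = d ^ i := by
        rw [← hdi, hd]
        ring
      have h3 : p * d ^ (i - 1) ≤ σ / 7 * d ^ i := by
        rw [← h2]
        have h4 : 0 ≤ p * d ^ (i - 1) := by positivity
        have := mul_le_mul_of_nonneg_left hnσ h4
        linarith
      linarith
    calc (p + 2 * p ^ 2) * K = m * (1 + 2 * p) * (1 + a) * (p * d ^ (i - 1)) := by
          rw [hK]
          ring
      _ ≤ m * (1 + σ / 7) * (1 + σ / 7) * ((1 + σ / 7) * (d ^ i / n)) := by gcongr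
      _ = (1 + σ / 7) ^ 3 * (m * (d ^ i / n)) := by ring
      _ ≤ (1 + 7 * (σ / 7)) * (m * (d ^ i / n)) := by
          refine mul_le_mul_of_nonneg_right ?_ (by positivity)
          exact one_add_pow_three_le (by linarith) (by linarith)
      _ ≤ _ := by
          have := mul_le_mul_of_nonneg_left hmD hσ.le
          linarith
  have hE : Real.exp (L * (1 - η)) * Real.exp (δ / 2 * L) ≤ n * q * q' := by
    rw [← hexpL, hq, hq', ← Real.exp_add, ← Real.exp_add, ← Real.exp_add, Real.exp_le_exp]
    have h1 := he₂ m hmn hme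
    have h2 : s * (2 * Real.exp (-(c / 2))) ≤ σ * L :=
      le_trans (mul_le_mul_of_nonneg_right hs1 (by positivity)) he₁
    have h3 : m * (d ^ i / n) + m * Real.exp (-c) ≤ (η - δ) * L := by
      rw [← mul_add]
      exact hmρ
    have h4 : 22 * σ * L ≤ δ * L := by gcongr
    linarith
  have hq'1 : q' ≤ 1 := by
    rw [hq', Real.exp_le_one_iff]
    have h1 : 0 ≤ s * (2 * Real.exp (-(c / 2))) := by positivity
    have h2 : 0 ≤ m * (e₂ + 2 * e₂ ^ 2) := by positivity
    linarith
  have hone : 1 ≤ Real.exp (L * (1 - η)) := Real.one_le_exp (mul_nonneg (by linarith) (by linarith))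
  have hR : ∀ R : Finset (Fin n), R.card = m →
      gnpProb n p {G | SphereGood G a d i ∧ NearAll G i ∧ Resolves G (R : Set (Fin n))} ≤
      Real.exp (-(n * q / 32)) + Real.exp (-(n * q / 4 * q' / 16)) := by
    intro R hR
    refine gnpProb_resolves_le (θ := θ) (K := K) (s := s) (t := t) (e₁ := Real.exp (-(c / 2)))
      (e₂ := e₂) hp hp' hi hd0 ha (by linarith) R (Real.exp_pos _).le (by rw [hR]) hKn
      (fun k hk => exp_neg_mul_le_one_sub_pow hp (by linarith) hk) ?_ ?_ ?_ ?_ ?_ ?_ ?_ ?_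
      (by rw [hR]) ?_
    · refine le_trans ?_ hat
      gcongr
    · rw [hR]
      have h1 : m ≤ L / c * d := (div_le_iff₀ hd0).1 hmd
      have h2 : 16 * L / c * d < t * d := by gcongr
      have h3 : 16 * L / c * d = 16 * (L / c * d) := by ring
      linarith
    · refine le_trans ?_ has
      gcongr
    · rw [hR]
      have h1 : m ≤ L / c * d := (div_le_iff₀ hd0).1 hmd
      have h2 : 4 * L / (c * θ) * (θ * d) < s * (θ * d) := by gcongr
      have h3 : 4 * L / (c * θ) * (θ * d) = 4 * (L / c * d) := by
        field_simp
      linarith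
    · refine Real.exp_le_exp.2 ?_
      linarith
    · exact hhalf _ (by linarith)
    · refine Real.exp_le_exp.2 ?_
      have : (1 - a - θ) * c ≤ (1 - a - θ) * (p * d ^ i) :=
        mul_le_mul_of_nonneg_left hpc (by linarith)
      linarith
    · refine hhalf _ ?_
      have := mul_le_mul hc2 (by linarith : 1 / 2 ≤ 1 - a - θ) (by norm_num) hc0.le
      linarith
    · have h1 : (2 : ℝ) ^ (t : ℝ) ≤ Real.exp t := by
        rw [← Real.exp_one_rpow]
        refine Real.rpow_le_rpow (by norm_num) ?_ (Nat.cast_nonneg _)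
        linarith [Real.add_one_le_exp (1 : ℝ)]
      have h2 : Real.exp t * 8 ≤ Real.exp (δ / 2 * L) := by
        rw [← Real.exp_log (by norm_num : (0 : ℝ) < 8), ← Real.exp_add, Real.exp_le_exp]
        linarith
      have h3 : Real.exp (δ / 2 * L) ≤ Real.exp (L * (1 - η)) * Real.exp (δ / 2 * L) :=
        le_mul_of_one_le_left (Real.exp_pos _).le hone
      linarith
  refine (gnpProb_mono hp hp' ?_).trans ((gnpProb_metricDim_le hp hp' hmn
    (by positivity) hR).trans ?_)
  · rintro G ⟨h1, h2, h3⟩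
    exact ⟨h1, h2, Nat.le_floor h3.le⟩
  · set E := Real.exp (L * (1 - η)) with hEdef
    have h1 : Real.exp (-(n * q / 32)) ≤ Real.exp (-(n * q / 4 * q' / 16)) := by
      refine Real.exp_le_exp.2 ?_
      have : n * q * q' ≤ n * q := mul_le_of_le_one_right (by positivity) hq'1
      have : 0 ≤ n * q := by positivity
      linarith
    have h2 : (n : ℝ) ^ m = Real.exp (m * L) := by
      rw [Real.exp_nat_mul, hexpL]
    have h3 : m * L ≤ L ^ 2 * E := by
      have h4 : E * d ^ i = n := by
        rw [hEdef, ← hexpη, ← hexpL, ← Real.exp_add]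
        congr 1
        ring
      have h5 : m * d ^ i ≤ L * E * d ^ i := by
        rw [mul_assoc, h4]
        exact hmD'
      have h6 := mul_le_mul_of_nonneg_right (le_of_mul_le_mul_right h5 hD0)
        (by linarith : 0 ≤ L)
      linarith
    have h7 : E * (64 * (L ^ 2 + L)) ≤ n * q * q' :=
      le_trans (mul_le_mul_of_nonneg_left hbig (by positivity)) hE
    have h8 : Real.exp (m * L) * Real.exp (-(n * q / 4 * q' / 16)) ≤ Real.exp (-L) := by
      rw [← Real.exp_add, Real.exp_le_exp]
      have : L ≤ L * E := le_mul_of_one_le_right (by linarith) hone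
      linarith
    rw [h2]
    calc Real.exp (m * L) * (Real.exp (-(n * q / 32)) + Real.exp (-(n * q / 4 * q' / 16)))
        ≤ Real.exp (m * L) * (Real.exp (-(n * q / 4 * q' / 16)) +
          Real.exp (-(n * q / 4 * q' / 16))) := by gcongr
      _ = 2 * (Real.exp (m * L) * Real.exp (-(n * q / 4 * q' / 16))) := by ring
      _ ≤ _ := by gcongr

lemma le_pow_sub_pow {n i k l : ℕ} {p d c a x ε : ℝ} (hp : 0 ≤ p) (hp' : p ≤ 1 / 2)
    (hn : 2 ≤ n) (hd : d = p * ((n : ℝ) - 1)) (hc : c = d ^ (i + 1) / n) (hc0 : 0 ≤ c)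
    (hd0 : 0 ≤ d) (hpx : 2 * p ≤ x) (ha : 0 ≤ a) (hax : a ≤ x) (hnx : 1 ≤ x * ((n : ℝ) - 1))
    (hx : x ≤ 1 / 4) (hcx : 7 * x * c ≤ ε / 4) (hcε : Real.exp (-(c / 2)) ≤ ε / 4)
    (hk : (k : ℝ) ≤ (1 + a) * d ^ i) (hl : 2 * (1 - a) * d ^ i ≤ l) :
    2 * ((1 - ε) * Real.exp (-c)) ≤ 2 * ((1 - p) ^ k - (1 - p) ^ l) := by
  obtain ⟨hpD, hpc⟩ := le_mul_pow_of_eq hn hd hc hc0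
  have hD0 : 0 ≤ d ^ i := by positivity
  have hx0 : 0 ≤ x := by linarith
  have h1 : (1 - p) ^ l ≤ ε / 4 * Real.exp (-c) := by
    refine (one_sub_pow_le_exp (by linarith) l).trans ?_
    calc Real.exp (-(p * l)) ≤ Real.exp (-(c / 2) + -c) := by
          refine Real.exp_le_exp.2 ?_
          have h2 := mul_le_mul_of_nonneg_left hl hp
          have h3 := mul_le_mul (by linarith : 3 / 2 ≤ 2 * (1 - a)) hpc hc0 (by linarith)
          linarith
      _ ≤ _ := by
          rw [Real.exp_add]
          gcongr
  have h2 : (1 - ε / 4) * Real.exp (-c) ≤ (1 - p) ^ k := by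
    refine le_trans ?_ (exp_neg_mul_le_one_sub_pow hp hp' hk)
    have h3 : p * d ^ i ≤ (1 + x) * c := by
      have h4 := mul_le_mul_of_nonneg_left hnx (by positivity : 0 ≤ p * d ^ i)
      have h5 : p * d ^ i * ((n : ℝ) - 1) ≤ (1 + x) * c * ((n : ℝ) - 1) := by
        rw [hpD]
        have := mul_le_mul_of_nonneg_left hnx hc0
        linarith
      have hn' : (2 : ℝ) ≤ n := by exact_mod_cast hn
      exact le_of_mul_le_mul_right h5 (by linarith)
    have h6 : (p + 2 * p ^ 2) * ((1 + a) * d ^ i) ≤ c + ε / 4 := by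
      calc (p + 2 * p ^ 2) * ((1 + a) * d ^ i) = (1 + 2 * p) * (1 + a) * (p * d ^ i) := by ring
        _ ≤ (1 + x) * (1 + x) * ((1 + x) * c) := by gcongr
        _ = (1 + x) ^ 3 * c := by ring
        _ ≤ (1 + 7 * x) * c :=
            mul_le_mul_of_nonneg_right (one_add_pow_three_le hx0 (by linarith)) hc0
        _ ≤ _ := by linarith
    calc (1 - ε / 4) * Real.exp (-c) ≤ Real.exp (-(ε / 4)) * Real.exp (-c) := by
          gcongr
          exact Real.one_sub_le_exp_neg _
      _ ≤ _ := by
          rw [← Real.exp_add, Real.exp_le_exp]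
          linarith
  have hε : 0 ≤ ε := by linarith [Real.exp_pos (-(c / 2))]
  have := mul_nonneg hε (Real.exp_pos (-c)).le
  linarith

/-- A given pair of vertices is very likely to be distinguished by about as many vertices as
expected. -/
lemma gnpProb_card_distinguishing_lt {n i : ℕ} {p d c a x ε L : ℝ} (hp : 0 ≤ p)
    (hp' : p ≤ 1 / 2) (hn : 2 ≤ n) (hL : L = Real.log n) (hL1 : 1 ≤ L)
    (hd : d = p * ((n : ℝ) - 1)) (hc : c = d ^ (i + 1) / n) (hc0 : 0 ≤ c) (hd0 : 0 ≤ d)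
    (ha : 0 ≤ a) (haε : a ≤ ε) (hx : c ≤ L → 2 * p ≤ x ∧ a ≤ x ∧ 1 ≤ x * ((n : ℝ) - 1))
    (hε : 0 ≤ ε) (hε' : ε ≤ 1 / 4) (hLx : 7 * x * L ≤ ε / 4)
    (hcε : Real.exp (-(c / 2)) ≤ ε / 4) (hdn : 4 * d ^ i ≤ ε * n)
    (hLd : 16 * L ≤ ε ^ 3 * d ^ i) {v w : Fin n} (hvw : v ≠ w) :
    gnpProb n p {G | SphereGood G a d i ∧ NearAll G i ∧
      ((distinguishing G v w).card : ℝ) < 2 * (1 - 4 * ε) * (n * (d ^ i / n + Real.exp (-c)))} ≤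
      Real.exp (-(4 * L)) := by
  have hn' : (2 : ℝ) ≤ n := by exact_mod_cast hn
  have hn0 : (0 : ℝ) < n := by linarith
  have hD0 : 0 ≤ d ^ i := by positivity
  have hν0 : 0 < Real.exp (-c) := Real.exp_pos _
  have hnρ : n * (d ^ i / n + Real.exp (-c)) = d ^ i + n * Real.exp (-c) := by
    field_simp
  have haD : a * d ^ i ≤ ε * d ^ i := by gcongr
  rw [hnρ]
  rcases lt_or_ge (n * Real.exp (-c)) (ε * d ^ i) with hsmall | hlarge
  · refine le_trans (le_of_eq ?_) (Real.exp_pos _).le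
    rw [← gnpProb_empty n p]
    congr 1
    ext G
    simp only [Set.mem_ofPred_eq, Set.mem_empty_iff_false, iff_false]
    rintro ⟨h1, h2, h3⟩
    have h4 := card_near_distinguishing h2 (h1.1 v).1 (h1.1 w).1 (h1.2 v w hvw)
    have h5 : ((distinguishing G v w ∩ reach G {v, w} (i + 1)).card : ℝ) ≤
        (distinguishing G v w).card := by
      exact_mod_cast Finset.card_le_card Finset.inter_subset_left
    have h6 : 0 ≤ ε * (n * Real.exp (-c)) := by positivity
    have h7 : ε * d ^ i ≤ 1 * d ^ i := by
      gcongr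
      linarith
    linarith
  · have hcL : c ≤ L := by
      have h1 : 1 ≤ ε * d ^ i := by
        have h2 : ε ^ 3 ≤ ε := by
          have := pow_le_pow_of_le_one hε (by linarith) (by norm_num : 1 ≤ 3)
          rwa [pow_one] at this
        have := mul_le_mul_of_nonneg_right h2 hD0
        linarith
      have h3 : Real.exp c ≤ Real.exp L := by
        rw [hL, Real.exp_log hn0]
        have h4 := mul_le_mul_of_nonneg_right (h1.trans hlarge) (Real.exp_pos c).le
        rw [mul_assoc, ← Real.exp_add] at h4
        simpa using h4
      exact Real.exp_le_exp.1 h3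
    obtain ⟨hpx, hax, hnx⟩ := hx hcL
    have hx0 : 0 ≤ x := by linarith
    have hx' : 7 * x ≤ ε / 4 := le_trans (le_mul_of_one_le_right (by positivity) hL1) hLx
    have hcx : 7 * x * c ≤ ε / 4 :=
      (mul_le_mul_of_nonneg_left hcL (by positivity)).trans hLx
    have hfew := gnpProb_few_distinguishing (i := i) (d := d) (a := a) (b := ε)
      (q := 2 * ((1 - ε) * Real.exp (-c))) hp (by linarith) hε (by linarith)
      (mul_nonneg (by norm_num) (mul_nonneg (by linarith) hν0.le))
      (fun k l hk hl => le_pow_sub_pow hp hp' hn hd hc hc0 hd0 hpx ha hax hnx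
        (by linarith) hcx hcε hk hl) v w
    have hout : (1 - ε) * n ≤ n - 2 * (1 + a) * d ^ i := by
      have : a * d ^ i ≤ 1 * d ^ i := by
        gcongr
        linarith
      linarith
    have hmean : (1 - ε) * n * (2 * ((1 - ε) * Real.exp (-c))) ≤
        (n - 2 * (1 + a) * d ^ i) * (2 * ((1 - ε) * Real.exp (-c))) :=
      mul_le_mul_of_nonneg_right hout
        (mul_nonneg (by norm_num) (mul_nonneg (by linarith) hν0.le))
    have hN0 : 0 ≤ n * Real.exp (-c) := by positivity
    refine (gnpProb_mono hp (by linarith) ?_).trans (hfew.trans (Real.exp_le_exp.2 ?_))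
    · rintro G ⟨h1, h2, h3⟩
      refine ⟨⟨(h1.1 v).1, (h1.1 w).1, h1.2 v w hvw⟩, h2, h3.le.trans ?_⟩
      have h4 := mul_le_mul_of_nonneg_left hmean (by linarith : 0 ≤ 1 - ε)
      have h5 : (1 - 4 * ε) * (n * Real.exp (-c)) ≤ (1 - ε) ^ 3 * (n * Real.exp (-c)) := by
        refine mul_le_mul_of_nonneg_right ?_ hN0
        have : 0 ≤ ε ^ 2 * (3 - ε) := mul_nonneg (by positivity) (by linarith)
        linarith
      have h6 : (1 - ε) * ((1 - ε) * n * (2 * ((1 - ε) * Real.exp (-c)))) =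
        2 * ((1 - ε) ^ 3 * (n * Real.exp (-c))) := by ring
      have h7 : 0 ≤ ε * d ^ i := by positivity
      linarith
    · rw [neg_le_neg_iff]
      have h4 := mul_le_mul_of_nonneg_left hmean (by positivity : 0 ≤ ε ^ 2 / 4)
      have h5 : n * Real.exp (-c) ≤ 2 * (1 - ε) ^ 2 * (n * Real.exp (-c)) := by
        refine le_mul_of_one_le_left hN0 ?_
        have := sq_nonneg ε
        linarith
      have h6 := mul_le_mul_of_nonneg_left (hlarge.trans h5) (by positivity : 0 ≤ ε ^ 2 / 4)
      have h7 : ε ^ 2 / 4 * (ε * d ^ i) = ε ^ 3 * d ^ i / 4 := by ring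
      have h8 : ε ^ 2 / 4 * ((1 - ε) * n * (2 * ((1 - ε) * Real.exp (-c)))) =
        ε ^ 2 / 4 * (2 * (1 - ε) ^ 2 * (n * Real.exp (-c))) := by ring
      linarith

/-- The probability that the metric dimension is large, in terms of explicit parameters. -/
lemma gnpProb_lt_metricDim {n i : ℕ} {p d c a x δ L : ℝ} (hp : 0 ≤ p)
    (hp' : p ≤ 1 / 2) (hn : 2 ≤ n) (hL : L = Real.log n) (hL1 : 1 ≤ L)
    (hd : d = p * ((n : ℝ) - 1)) (hc : c = d ^ (i + 1) / n) (hc0 : 0 ≤ c) (hd0 : 0 ≤ d)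
    (ha : 0 ≤ a) (haδ : a ≤ δ / 16)
    (hx : c ≤ L → 2 * p ≤ x ∧ a ≤ x ∧ 1 ≤ x * ((n : ℝ) - 1)) (hδ : 0 < δ) (hδ' : δ ≤ 1)
    (hLx : 7 * x * L ≤ δ / 64)
    (hcδ : Real.exp (-(c / 2)) ≤ δ / 64) (hdn : 4 * d ^ i ≤ δ / 16 * n)
    (hLd : 16 * L ≤ (δ / 16) ^ 3 * d ^ i) (hδL : 4 < δ * L) :
    gnpProb n p {G | SphereGood G a d i ∧ NearAll G i ∧
      (1 + δ) * ((d ^ i / n + Real.exp (-c))⁻¹ * L) < (metricDim G : ℝ)} ≤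
      (n : ℝ) ^ 2 * Real.exp (-(4 * L)) := by
  have hn' : (2 : ℝ) ≤ n := by exact_mod_cast hn
  have hn0 : (0 : ℝ) < n := by linarith
  have hD0 : 0 ≤ d ^ i := by positivity
  set ρ := d ^ i / n + Real.exp (-c) with hρ
  have hρ0 : 0 < ρ := by positivity
  have hρ2 : ρ ≤ 2 := by
    have h1 : d ^ i / n ≤ 1 := by
      rw [div_le_one hn0]
      have : δ / 16 * n ≤ 1 * n := by
        gcongr
        linarith
      linarith
    have h2 : Real.exp (-c) ≤ 1 := Real.exp_le_one_iff.2 (by linarith)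
    linarith
  have hbad := gnpProb_biUnion_le (n := n) (p := p) hp (by linarith)
    (Finset.univ.filter fun e : Fin n × Fin n => e.1 ≠ e.2)
    (fun e => {G | SphereGood G a d i ∧ NearAll G i ∧
      ((distinguishing G e.1 e.2).card : ℝ) < 2 * (1 - 4 * (δ / 16)) * (n * ρ)})
    (fun e he => gnpProb_card_distinguishing_lt hp hp' hn hL hL1 hd hc hc0 hd0 ha haδ hx
      (by linarith)
      (by linarith) (by linarith) (by linarith) hdn hLd (Finset.mem_filter.1 he).2)
  refine (gnpProb_mono hp (by linarith) ?_).trans (hbad.trans ?_)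
  · rintro G ⟨h1, h2, h3⟩
    by_contra hcon
    refine h3.not_ge ?_
    have h4 : ∀ v w, v ≠ w → 2 * (1 - 4 * (δ / 16)) * (n * ρ) ≤ (distinguishing G v w).card := by
      intro v w hvw
      by_contra h
      exact hcon ⟨(v, w), Finset.mem_filter.2 ⟨Finset.mem_univ _, hvw⟩, h1, h2, not_le.1 h⟩
    have h5 : 0 ≤ (1 + δ) * (ρ⁻¹ * L) := by positivity
    refine le_trans ?_ (Nat.floor_le h5)
    refine Nat.cast_le.2 (metricDim_le_of_distinguishing (by omega) h4 ?_)
    rw [← hL]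
    have h6 := Nat.lt_floor_add_one ((1 + δ) * (ρ⁻¹ * L))
    set m := ⌊(1 + δ) * (ρ⁻¹ * L)⌋₊ with hm
    have h7 : (1 + δ) * L < ρ * (m + 1) := by
      have := mul_lt_mul_of_pos_left h6 hρ0
      have h8 : ρ * ((1 + δ) * (ρ⁻¹ * L)) = (1 + δ) * L := by field_simp
      linarith
    have h9 : L < (1 - δ / 4) * (ρ * m) := by
      have h10 : (1 + δ) * L - 2 ≤ ρ * m := by linarith
      have h11 := mul_le_mul_of_nonneg_left h10 (by linarith : 0 ≤ 1 - δ / 4)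
      have h12 : 0 ≤ (1 - δ) * (δ * L) := mul_nonneg (by linarith) (by linarith)
      linarith
    have h13 := mul_lt_mul_of_pos_left h9 (by positivity : 0 < 2 * (n : ℝ))
    linarith
  · refine mul_le_mul_of_nonneg_right ?_ (Real.exp_pos _).le
    have h1 : (Finset.univ.filter fun e : Fin n × Fin n => e.1 ≠ e.2).card ≤ n ^ 2 := by
      refine (Finset.card_le_univ _).trans (le_of_eq ?_)
      rw [Fintype.card_prod, Fintype.card_fin, sq]
    exact_mod_cast h1

set_option maxHeartbeats 1000000 in
/-- The failure probability of the two-sided bound, in terms of explicit parameters. -/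
lemma gnpProb_not_metricDim_bounds {n i : ℕ} {p d c γ a θ σ δ x L η : ℝ} (hp : 0 ≤ p)
    (hi : 1 ≤ i) (hn : 16 ≤ n) (hL : L = Real.log n) (hL1 : 1 ≤ L)
    (hd : d = p * ((n : ℝ) - 1)) (hc : c = d ^ (i + 1) / n)
    (hη : η = Real.log (d ^ i) / Real.log n) (hγ : 0 ≤ γ) (hγ' : γ ≤ 1) (ha : a = 8 * (i * γ))
    (hγn : 1 ≤ γ * ((n : ℝ) - 1)) (hdγ : 8 * d ^ i ≤ γ * n) (hγd : 64 * L ≤ γ ^ 2 * d)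
    (hσ : 0 < σ) (hσδ : 22 * σ ≤ δ) (hδ' : δ ≤ 1) (hpσ : 2 * p ≤ σ / 7) (haσ : a ≤ σ / 7)
    (hnσ : 1 ≤ σ / 7 * ((n : ℝ) - 1)) (hθ : 0 < θ) (haθ : a + θ ≤ 1 / 2) (hc2 : 2 ≤ c)
    (hat : 8 * a * (16 * L / c + 1) ≤ 1 / 4) (has : 8 * a * (4 * L / (c * θ) + 1) ≤ θ)
    (he₁ : (4 * L / (c * θ) + 1) * (2 * Real.exp (-(c / 2))) ≤ σ * L)
    (he₂ : ∀ m : ℕ, m ≤ n → m * Real.exp (-c) ≤ L → m * (Real.exp (-(c * (1 - a - θ))) +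
      2 * Real.exp (-(c * (1 - a - θ))) ^ 2) ≤ m * Real.exp (-c) + 9 * σ * L)
    (hmany : 16 * L / c + 1 + Real.log 8 ≤ δ / 2 * L)
    (hbig : 64 * (L ^ 2 + L) ≤ Real.exp (δ / 2 * L))
    (hx : c ≤ L → 2 * p ≤ x ∧ a ≤ x ∧ 1 ≤ x * ((n : ℝ) - 1)) (hLx : 7 * x * L ≤ δ / 64)
    (hcδ : Real.exp (-(c / 2)) ≤ δ / 64) (hdn : 4 * d ^ i ≤ δ / 16 * n)
    (hLd : 16 * L ≤ (δ / 16) ^ 3 * d ^ i) (hδL : 4 < δ * L) :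
    gnpProb n p {G | (η - δ) * ((d ^ i / n + Real.exp (-c))⁻¹ * L) ≤ (metricDim G : ℝ) ∧
        (metricDim G : ℝ) ≤ (1 + δ) * ((d ^ i / n + Real.exp (-c))⁻¹ * L)}ᶜ ≤
      (2 * i + 4) * Real.exp (-L) := by
  have hn' : (16 : ℝ) ≤ n := by exact_mod_cast hn
  have hn0 : (0 : ℝ) < n := by linarith
  have hp' : p ≤ 1 / 2 := by linarith
  have hp1 : p ≤ 1 := by linarith
  have hd64 : 64 * L ≤ d := by
    have hd0 : 0 ≤ d := by
      rw [hd]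
      exact mul_nonneg hp (by linarith)
    exact hγd.trans (mul_le_of_le_one_left hd0 (pow_le_one₀ hγ hγ'))
  have hd0 : 0 ≤ d := by linarith
  have ha0 : 0 ≤ a := by
    rw [ha]
    positivity
  have hγd2 : 2 ≤ γ * d := by
    have : γ ^ 2 * d ≤ γ * d := by
      gcongr
      rw [sq]
      exact mul_le_of_le_one_left hγ hγ'
    linarith
  have hDn : 8 * d ^ i ≤ n := hdγ.trans (mul_le_of_le_one_left hn0.le hγ')
  have hD0 : 0 ≤ d ^ i := by positivity
  have hexp : (n : ℝ) ^ 2 * Real.exp (-(4 * L)) ≤ Real.exp (-L) := by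
    rw [← Real.exp_log hn0, ← hL, ← Real.exp_nat_mul, ← Real.exp_add, Real.exp_le_exp]
    push_cast
    linarith
  have hsphere := gnpProb_not_sphereGood (i := i) hp hp1 hi hd (by linarith) hγ (by linarith) hγn
    hdγ hγd2
  rw [← ha] at hsphere
  have hsphere' : (n : ℝ) ^ 2 * (i * (2 * Real.exp (-(γ ^ 2 * d / 16)))) ≤
      2 * i * Real.exp (-L) := by
    have : Real.exp (-(γ ^ 2 * d / 16)) ≤ Real.exp (-(4 * L)) :=
      Real.exp_le_exp.2 (by linarith)
    calc (n : ℝ) ^ 2 * (i * (2 * Real.exp (-(γ ^ 2 * d / 16))))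
        ≤ (n : ℝ) ^ 2 * (i * (2 * Real.exp (-(4 * L)))) := by gcongr
      _ = 2 * i * ((n : ℝ) ^ 2 * Real.exp (-(4 * L))) := by ring
      _ ≤ _ := by gcongr
  have hnear := gnpProb_sphereGood_not_nearAll (a := a) (i := i) hp hp1 hd0 ha0 (by linarith) hDn
    (hc2.trans (le_mul_pow_of_eq (by omega) hd hc (by linarith)).2) hn
  have hnear' : (n : ℝ) ^ 2 * Real.exp (-(n * p / 16)) ≤ Real.exp (-L) := by
    refine le_trans ?_ hexp
    gcongr
    linarith
  have hlow := gnpProb_metricDim_lt hp hp1 hi (by omega) hL hL1 hd hc hη (by linarith)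
    (by linarith) hσ hσδ hpσ haσ hnσ ha0 hθ haθ hc2 hat has he₁ he₂ hmany hbig
  have hup := gnpProb_lt_metricDim hp hp' (by omega) hL hL1 hd hc (by linarith) hd0 ha0
    (by linarith) hx (by linarith) hδ' hLx hcδ hdn hLd hδL
  refine (gnpProb_le_add hp hp1 ?_ (hsphere.trans hsphere') (gnpProb_le_add hp hp1 subset_rfl
    (hnear.trans hnear') (gnpProb_le_add hp hp1 subset_rfl hlow (hup.trans hexp)))).trans
    (by linarith)
  intro G hG
  by_cases h1 : SphereGood G a d i
  · by_cases h2 : NearAll G i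
    · rcases not_and_or.1 hG with h | h
      · exact Or.inr (Or.inr (Or.inl ⟨h1, h2, not_le.1 h⟩))
      · exact Or.inr (Or.inr (Or.inr ⟨h1, h2, not_le.1 h⟩))
    · exact Or.inr (Or.inl ⟨h1, h2⟩)
  · exact Or.inl h1

lemma mul_exp_add_sq_le_of_le {c a θ σ L m : ℝ} (hm : 0 ≤ m) (hσ : 0 ≤ σ) (hσ' : σ ≤ 1 / 22)
    (hca : c * a ≤ σ / 10) (hcθ : c * θ ≤ σ) (hca0 : 0 ≤ c * a) (hcθ0 : 0 ≤ c * θ)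
    (hcσ : Real.exp (-c) ≤ σ / 4)
    (hmL : m * Real.exp (-c) ≤ L) :
    m * (Real.exp (-(c * (1 - a - θ))) + 2 * Real.exp (-(c * (1 - a - θ))) ^ 2) ≤
      m * Real.exp (-c) + 9 * σ * L := by
  set e := Real.exp (-c) with he
  have he0 : 0 < e := Real.exp_pos _
  have h1 : Real.exp (-(c * (1 - a - θ))) = e * Real.exp (c * a + c * θ) := by
    rw [he, ← Real.exp_add]
    congr 1
    ring
  have h2 : Real.exp (c * a + c * θ) ≤ 1 + 2 * σ := by
    have h3 := abs_le.1 (Real.abs_exp_sub_one_sub_id_le (x := c * a + c * θ)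
      (by rw [abs_of_nonneg (by linarith)]; linarith))
    have h4 : (c * a + c * θ) ^ 2 ≤ (11 / 10 * σ) ^ 2 :=
      pow_le_pow_left₀ (by linarith) (by linarith) 2
    have h5 : σ * σ ≤ 1 / 22 * σ := by gcongr
    linarith
  set f := Real.exp (-(c * (1 - a - θ))) with hf
  have h3 : f ≤ e * (1 + 2 * σ) := by
    rw [h1]
    gcongr
  have h4 : 2 * f ≤ σ := by
    have : e * (1 + 2 * σ) ≤ σ / 4 * 2 := by
      gcongr
      linarith
    linarith
  have hf0 : 0 < f := Real.exp_pos _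
  calc m * (f + 2 * f ^ 2) = m * (f * (1 + 2 * f)) := by ring
    _ ≤ m * (e * (1 + 2 * σ) * (1 + σ)) := by gcongr
    _ = m * e + (3 + 2 * σ) * σ * (m * e) := by ring
    _ ≤ m * e + 9 * σ * L := by
        have h5 : 0 ≤ m * e := by positivity
        gcongr
        linarith

lemma mul_exp_add_sq_le_of_card_le {n m : ℕ} {c b σ L : ℝ} (hn : 1 ≤ n) (hL : L = Real.log n)
    (hm : m ≤ n) (hc : 2 * L ≤ c * b) (hσ : 3 ≤ 9 * σ * L * n) :
    m * (Real.exp (-(c * b)) + 2 * Real.exp (-(c * b)) ^ 2) ≤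
      m * Real.exp (-c) + 9 * σ * L := by
  have hn' : (1 : ℝ) ≤ n := by exact_mod_cast hn
  have hn0 : (0 : ℝ) < n := by linarith
  have hm' : (m : ℝ) ≤ n := by exact_mod_cast hm
  have h1 : Real.exp (-(c * b)) ≤ ((n : ℝ) ^ 2)⁻¹ := by
    rw [Real.exp_neg]
    gcongr
    rw [← Real.exp_log hn0, ← hL, ← Real.exp_nat_mul, Real.exp_le_exp]
    exact_mod_cast hc
  have h2 : ((n : ℝ) ^ 2)⁻¹ ≤ 1 := inv_le_one_of_one_le₀ (one_le_pow₀ hn')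
  set f := Real.exp (-(c * b)) with hf
  have hf0 : 0 < f := Real.exp_pos _
  have h3 : f + 2 * f ^ 2 ≤ 3 * ((n : ℝ) ^ 2)⁻¹ := by
    have : f * f ≤ f * 1 := by
      gcongr
      exact h1.trans h2
    linarith
  have h4 : m * (f + 2 * f ^ 2) ≤ n * (3 * ((n : ℝ) ^ 2)⁻¹) := by gcongr
  have h5 : n * (3 * ((n : ℝ) ^ 2)⁻¹) ≤ 9 * σ * L := by
    have : n * (3 * ((n : ℝ) ^ 2)⁻¹) = 3 / n := by
      field_simp
    rw [this, div_le_iff₀ hn0]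
    exact hσ
  have h6 : 0 ≤ m * Real.exp (-c) := by positivity
  linarith

set_option maxHeartbeats 1000000 in
/-- The failure probability of the two-sided bound, for `n` large in terms of `σ` and `i`. -/
lemma gnpProb_not_metricDim_bounds_of_large {n i : ℕ} {p d c κ σ L η : ℝ} (hp : 0 ≤ p)
    (hi : 1 ≤ i) (hL : L = Real.log n) (hd : d = p * ((n : ℝ) - 1)) (hc : c = d ^ (i + 1) / n)
    (hη : η = Real.log (d ^ i) / Real.log n) (hσ : 0 < σ) (hσ' : σ ≤ 1 / 22) (hκ : 0 < κ)
    (hκσ : 8 * (i * κ) = σ ^ 2 / 1250) (hLσ : 1 ≤ σ ^ 3 * L) (hdL : 64 * L ^ 5 ≤ κ ^ 2 * d)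
    (hDn : 100 * d ^ i ≤ κ * σ * n) (hn : 1000 * L ^ 2 ≤ κ * σ * ((n : ℝ) - 1))
    (hcσ : Real.exp (-(c / 2)) ≤ σ ^ 2 / 100) (hσc : 4 ≤ σ * c) :
    gnpProb n p {G | (η - 22 * σ) * ((d ^ i / n + Real.exp (-c))⁻¹ * L) ≤ (metricDim G : ℝ) ∧
        (metricDim G : ℝ) ≤ (1 + 22 * σ) * ((d ^ i / n + Real.exp (-c))⁻¹ * L)}ᶜ ≤
      (2 * i + 4) * Real.exp (-L) := by
  have hi' : (1 : ℝ) ≤ i := by exact_mod_cast hi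
  have hσ2 : σ ^ 2 ≤ σ / 22 := by
    have : σ * σ ≤ σ * (1 / 22) := by gcongr
    linarith
  have hσ3 : σ ^ 3 ≤ σ := by
    have := pow_le_pow_of_le_one hσ.le (by linarith) (by norm_num : 1 ≤ 3)
    rwa [pow_one] at this
  have hκ' : κ ≤ σ ^ 2 / 10000 := by
    have : 1 * κ ≤ i * κ := by gcongr
    linarith
  have hκ1 : κ ≤ 1 := by linarith
  have hL0 : 0 < L := by
    by_contra h
    have := mul_nonpos_of_nonneg_of_nonpos (by positivity : 0 ≤ σ ^ 3) (not_lt.1 h)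
    linarith
  have hσL : 1 ≤ σ * L := hLσ.trans (by gcongr)
  have hL1 : 1 ≤ L := hσL.trans (mul_le_of_le_one_left hL0.le (by linarith))
  have hL2 : L ≤ L ^ 2 := by
    have := pow_le_pow_right₀ hL1 (by norm_num : 1 ≤ 2)
    rwa [pow_one] at this
  have hκσ1 : κ * σ ≤ 1 := by
    calc κ * σ ≤ 1 * 1 := by
          gcongr
          linarith
      _ = 1 := one_mul 1
  have hn1 : 1000 ≤ (n : ℝ) - 1 := by
    have h1 : 0 ≤ (n : ℝ) - 1 := by
      by_contra h
      have := mul_nonpos_of_nonneg_of_nonpos (by positivity : 0 ≤ κ * σ) (not_le.1 h).le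
      linarith
    have := mul_le_of_le_one_left h1 hκσ1
    linarith
  have hn0 : (0 : ℝ) < n := by linarith
  have hn16 : 16 ≤ n := by
    have : (16 : ℝ) ≤ n := by linarith
    exact_mod_cast this
  have hn1' : (0 : ℝ) ≤ (n : ℝ) - 1 := by linarith
  have hd0 : 0 ≤ d := by
    rw [hd]
    exact mul_nonneg hp hn1'
  have hκn : 1000 * L ^ 2 ≤ κ * ((n : ℝ) - 1) :=
    hn.trans (mul_le_mul_of_nonneg_right (mul_le_of_le_one_right hκ.le (by linarith)) hn1')
  have hσn : 1000 * L ^ 2 ≤ σ * ((n : ℝ) - 1) :=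
    hn.trans (mul_le_mul_of_nonneg_right (mul_le_of_le_one_left hσ.le hκ1) hn1')
  have hκd : 64 * L ^ 5 ≤ κ * d := by
    refine hdL.trans (mul_le_mul_of_nonneg_right ?_ hd0)
    rw [sq]
    exact mul_le_of_le_one_left hκ.le hκ1
  have hL5 : L ≤ L ^ 5 := by
    have := pow_le_pow_right₀ hL1 (by norm_num : 1 ≤ 5)
    rwa [pow_one] at this
  have hκd' := mul_le_of_le_one_left hd0 hκ1
  have hd1 : 1 ≤ d := by linarith
  have hdD : d ≤ d ^ i := by
    have := pow_le_pow_right₀ hd1 hi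
    rwa [pow_one] at this
  have hD0 : 0 ≤ d ^ i := by positivity
  have hc4 : 88 ≤ c := by
    have h0 : 0 ≤ c := by
      by_contra h
      have := mul_nonpos_of_nonneg_of_nonpos hσ.le (not_le.1 h).le
      linarith
    have := mul_le_mul_of_nonneg_right hσ' h0
    linarith
  have hDσ : 100 * d ^ i ≤ σ * n :=
    hDn.trans (mul_le_mul_of_nonneg_right (mul_le_of_le_one_left hσ.le hκ1) hn0.le)
  have hDκ : 100 * d ^ i ≤ κ * n :=
    hDn.trans (mul_le_mul_of_nonneg_right (mul_le_of_le_one_right hκ.le (by linarith)) hn0.le)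
  have hpn : ∀ {y : ℝ}, 2 * d ^ i ≤ y * ((n : ℝ) - 1) → 2 * p ≤ y := by
    intro y hy
    have : 2 * p * ((n : ℝ) - 1) ≤ y * ((n : ℝ) - 1) := by linarith
    exact le_of_mul_le_mul_right this (by linarith)
  have hpσ : 2 * p ≤ σ / 7 := hpn (by linarith)
  have hLc : 16 * L / c ≤ 4 * (σ * L) := by
    rw [div_le_iff₀ (by linarith)]
    have := mul_le_mul_of_nonneg_right hσc hL0.le
    linarith
  have hlog8 : Real.log 8 ≤ 3 := by
    rw [show (8 : ℝ) = 2 ^ 3 by norm_num, Real.log_pow]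
    push_cast
    linarith [Real.log_two_lt_d9]
  have hbig : 64 * (L ^ 2 + L) ≤ Real.exp (22 * σ / 2 * L) := by
    have h1 := Real.pow_div_factorial_le_exp (22 * σ / 2 * L) (by positivity) 3
    have h2 := mul_le_mul_of_nonneg_right hLσ (sq_nonneg L)
    have h3 : (22 * σ / 2 * L) ^ 3 / (Nat.factorial 3 : ℕ) = 1331 / 6 * (σ ^ 3 * L * L ^ 2) := by
      norm_num [Nat.factorial]
      ring
    rw [h3] at h1
    linarith
  have hLd : 16 * L ≤ (22 * σ / 16) ^ 3 * d ^ i := by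
    have h1 : κ ^ 2 ≤ (22 * σ / 16) ^ 3 := by
      calc κ ^ 2 ≤ (σ ^ 2 / 10000) ^ 2 := by gcongr
        _ = σ ^ 3 * (σ / 10000 ^ 2) := by ring
        _ ≤ σ ^ 3 * 1 := by
            gcongr
            linarith
        _ ≤ (22 * σ / 16) ^ 3 := by
            rw [mul_one]
            gcongr
            linarith
    have h2 : κ ^ 2 * d ≤ (22 * σ / 16) ^ 3 * d ^ i := by gcongr
    linarith
  have hσ20 : 0 ≤ σ ^ 2 := sq_nonneg σ
  have hexp0 := Real.exp_pos (-(c / 2))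
  rcases le_or_gt c (4 * L) with hcL | hcL
  · set a := 8 * (i * (κ / L ^ 2)) with ha
    have ha' : a = σ ^ 2 / 1250 / L ^ 2 := by
      rw [← hκσ, ha]
      ring
    have haL : a * L ^ 2 = σ ^ 2 / 1250 := by
      rw [ha']
      field_simp
    have ha0 : 0 ≤ a := by
      rw [ha]
      positivity
    have haL1 : a * L ≤ σ ^ 2 / 1250 :=
      le_trans (mul_le_mul_of_nonneg_left hL2 ha0) haL.le
    have ha1 : a ≤ σ ^ 2 / 1250 := le_trans (le_mul_of_one_le_right ha0 hL1) haL1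
    have hDL : 16 * (L ^ 2 * d ^ i) ≤ κ * n := by
      have h1 : d ^ i * d = c * n := by
        rw [hc, div_mul_cancel₀ _ hn0.ne', pow_succ]
      have h2 : 16 * (L ^ 2 * d ^ i) * d ≤ κ * n * d := by
        calc 16 * (L ^ 2 * d ^ i) * d = 16 * L ^ 2 * (d ^ i * d) := by ring
          _ = 16 * L ^ 2 * c * n := by rw [h1]; ring
          _ ≤ 16 * L ^ 2 * (4 * L) * n := by gcongr
          _ = 64 * L ^ 3 * n := by ring
          _ ≤ 64 * L ^ 5 * n := by
              gcongr
              norm_num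
          _ ≤ κ * d * n := by gcongr
          _ = _ := by ring
      exact le_of_mul_le_mul_right h2 (by linarith)
    have hcθ : c * (σ / c) = σ := by field_simp
    have hcθ' : σ / c ≤ σ / 4 := by
      gcongr
      linarith
    have hLσ' : 4 * L / (c * (σ / c)) + 1 ≤ 5 * L / σ := by
      rw [hcθ, div_add_one hσ.ne', div_le_div_iff_of_pos_right hσ]
      linarith
    refine gnpProb_not_metricDim_bounds (γ := κ / L ^ 2) (a := a) (θ := σ / c) (σ := σ)
      (x := 22 * σ / (448 * L)) hp hi hn16 hL hL1 hd hc hη (by positivity) ?_ ha ?_ ?_ ?_ hσ le_rfl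
      (by linarith) hpσ (by linarith) (by linarith) (by positivity) (by linarith) (by linarith)
      ?_ ?_ ?_ ?_ (by linarith) hbig ?_ ?_ (by linarith) (by linarith) hLd (by linarith)
    · rw [div_le_one (by positivity)]
      linarith
    · rw [div_mul_eq_mul_div, le_div_iff₀ (by positivity)]
      linarith
    · rw [div_mul_eq_mul_div, le_div_iff₀ (by positivity)]
      linarith [mul_nonneg (sq_nonneg L) hD0]
    · rw [div_pow, div_mul_eq_mul_div, le_div_iff₀ (by positivity)]
      calc 64 * L * (L ^ 2) ^ 2 = 64 * L ^ 5 := by ring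
        _ ≤ _ := hdL
    · have h1 : 16 * L / c ≤ 16 * L / 1 := by
        gcongr
        linarith
      have h2 := mul_le_mul_of_nonneg_left h1 ha0
      linarith
    · rw [le_div_iff₀ (by linarith)]
      calc 8 * a * (4 * L / (c * (σ / c)) + 1) * c ≤ 8 * a * (5 * L / σ) * (4 * L) := by gcongr
        _ = 160 * (a * L ^ 2) / σ := by ring
        _ = 160 / 1250 * σ := by
            rw [haL]
            field_simp
        _ ≤ σ := by linarith
    · calc (4 * L / (c * (σ / c)) + 1) * (2 * Real.exp (-(c / 2)))
          ≤ 5 * L / σ * (2 * (σ ^ 2 / 100)) := by gcongr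
        _ = σ * L / 10 := by
            field_simp
            norm_num
        _ ≤ _ := by linarith
    · intro m hm hmL
      have hca : c * a ≤ 4 * L * a := by gcongr
      refine mul_exp_add_sq_le_of_le (Nat.cast_nonneg m) hσ.le hσ' (by linarith) hcθ.le
        (mul_nonneg (by linarith) ha0) (by rw [hcθ]; exact hσ.le) ?_ hmL
      have : Real.exp (-c) ≤ Real.exp (-(c / 2)) := Real.exp_le_exp.2 (by linarith)
      linarith
    · intro _
      refine ⟨hpn ?_, ?_, ?_⟩
      · rw [div_mul_eq_mul_div, le_div_iff₀ (by positivity)]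
        have h1 : L * d ^ i ≤ L ^ 2 * d ^ i := by gcongr
        have h2 : κ * n ≤ σ / 10000 * n := by
          gcongr
          linarith
        have h3 : 0 ≤ σ * ((n : ℝ) - 2) := mul_nonneg hσ.le (by linarith)
        linarith
      · rw [le_div_iff₀ (by positivity)]
        linarith
      · rw [div_mul_eq_mul_div, le_div_iff₀ (by positivity)]
        linarith
    · refine le_of_eq ?_
      field_simp
      norm_num
  · have hLc' : L / c ≤ 1 / 4 := by
      rw [div_le_iff₀ (by linarith)]
      linarith
    have h16 : 16 * L / c ≤ 4 := by
      rw [mul_div_assoc]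
      linarith
    have h16' : 4 * L / (c * (1 / 4)) ≤ 4 := by
      have : 4 * L / (c * (1 / 4)) = 16 * L / c := by
        field_simp
        norm_num
      rw [this]
      exact h16
    set a := 8 * (i * κ) with ha
    have ha0 : 0 ≤ a := by
      rw [ha]
      positivity
    have h8a := mul_le_mul_of_nonneg_left h16 ha0
    have h8a' := mul_le_mul_of_nonneg_left h16' ha0
    refine gnpProb_not_metricDim_bounds (γ := κ) (a := a) (θ := 1 / 4) (σ := σ)
      (x := 0) hp hi hn16 hL hL1 hd hc hη hκ.le hκ1 ha (by linarith) (by linarith)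
      (by linarith) hσ le_rfl (by linarith) hpσ (by linarith) (by linarith) (by norm_num)
      (by linarith) (by linarith) (by linarith) (by linarith) ?_ ?_ (by linarith) hbig ?_
      (by linarith) (by linarith) (by linarith) hLd (by linarith)
    · calc (4 * L / (c * (1 / 4)) + 1) * (2 * Real.exp (-(c / 2)))
          ≤ (4 + 1) * (2 * (σ ^ 2 / 100)) := by gcongr
        _ ≤ σ * L := by linarith
    · intro m hm _
      refine mul_exp_add_sq_le_of_card_le (by omega) hL hm ?_ ?_
      · have := mul_le_mul hcL.le (by linarith : 1 / 2 ≤ 1 - a - 1 / 4) (by norm_num) (by linarith)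
        linarith
      · have := mul_le_mul_of_nonneg_right hσL hn0.le
        linarith
    · intro h
      linarith

lemma tendsto_log_div_log_log_atTop :
    Tendsto (fun n : ℕ => Real.log n / (3 * Real.log (Real.log n))) atTop atTop := by
  have hlog : Tendsto (fun n : ℕ => Real.log n) atTop atTop :=
    Real.tendsto_log_atTop.comp tendsto_natCast_atTop_atTop
  refine tendsto_atTop.2 fun M => ?_
  have hM : 0 < (3 * (|M| + 1))⁻¹ := by positivity
  have h1 := hlog.eventually (Real.isLittleO_log_id_atTop.bound hM)
  have h2 := hlog.eventually (eventually_gt_atTop (Real.exp 1))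
  filter_upwards [h1, h2] with n hn hn'
  have hL0 : 0 < Real.log n := (Real.exp_pos 1).trans hn'
  have hLL : 1 < Real.log (Real.log n) := (Real.lt_log_iff_exp_lt hL0).2 hn'
  rw [id, Real.norm_eq_abs, Real.norm_eq_abs, abs_of_pos hL0, abs_of_pos (by linarith),
    inv_mul_eq_div, le_div_iff₀ (by positivity)] at hn
  rw [le_div_iff₀ (by positivity)]
  have h3 : M * (3 * Real.log (Real.log n)) ≤ (|M| + 1) * (3 * Real.log (Real.log n)) := by
    gcongr
    linarith [le_abs_self M]
  linarith

lemma metricDim_bounds_mono {η δ δ' b x : ℝ} (hδ : δ ≤ δ') (hb : 0 ≤ b)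
    (h : (η - δ) * b ≤ x ∧ x ≤ (1 + δ) * b) : (η - δ') * b ≤ x ∧ x ≤ (1 + δ') * b := by
  refine ⟨le_trans ?_ h.1, h.2.trans ?_⟩ <;> gcongr

end

theorem stmt_2 (p d c η : ℕ → ℝ)
    (hp : ∀ n, 0 ≤ p n ∧ p n ≤ 1)
    (hd : ∀ n, d n = p n * ((n : ℝ) - 1))
    (hd_lower : Tendsto (fun n : ℕ => d n / (Real.log n) ^ 5) atTop atTop)
    (hd_upper : ∀ᶠ n : ℕ in atTop,
      d n ≤ (n : ℝ) * (1 - 3 * Real.log (Real.log n) / Real.log n))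
    (i : ℕ)
    (hi : (fun n : ℕ => d n ^ i) =o[atTop] (fun n : ℕ => (n : ℝ)))
    (hi_max : ∀ j : ℕ, ((fun n : ℕ => d n ^ j) =o[atTop] (fun n : ℕ => (n : ℝ))) → j ≤ i)
    (hc : ∀ n : ℕ, c n = d n ^ (i + 1) / n)
    (hη : ∀ n : ℕ, η n = Real.log (d n ^ i) / Real.log n)
    (hec : ∀ᶠ n : ℕ in atTop,
      Real.log n / (3 * Real.log (Real.log n)) < Real.exp (c n)) :
    ∀ δ : ℝ, 0 < δ →
      Tendsto (fun n : ℕ => gnpProb n (p n)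
        {G : SimpleGraph (Fin n) |
          (η n - δ) * ((d n ^ i / n + Real.exp (-c n))⁻¹ * Real.log n) ≤
            (metricDim G : ℝ) ∧
          (metricDim G : ℝ) ≤
            (1 + δ) * ((d n ^ i / n + Real.exp (-c n))⁻¹ * Real.log n)})
        atTop (𝓝 1) := by
  intro δ hδ
  have hcast : Tendsto (fun n : ℕ => (n : ℝ)) atTop atTop := tendsto_natCast_atTop_atTop
  have hlog : Tendsto (fun n : ℕ => Real.log n) atTop atTop :=
    Real.tendsto_log_atTop.comp hcast
  have hcM : ∀ M : ℝ, ∀ᶠ n : ℕ in atTop, M ≤ c n := by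
    intro M
    filter_upwards [hec, tendsto_log_div_log_log_atTop.eventually_ge_atTop (Real.exp M)]
      with n h1 h2
    exact (Real.exp_lt_exp.1 (h2.trans_lt h1)).le
  have hi1 : 1 ≤ i := by
    by_contra h
    obtain rfl : i = 0 := by omega
    obtain ⟨n, h1, h2⟩ := ((hcM 2).and (eventually_ge_atTop 1)).exists
    have h2' : (1 : ℝ) ≤ n := by exact_mod_cast h2
    rw [hc, hd, zero_add, pow_one, le_div_iff₀ (by linarith)] at h1
    have h3 := mul_le_mul_of_nonneg_right (hp n).2 (by linarith : 0 ≤ (n : ℝ) - 1)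
    linarith
  have hi0 : (0 : ℝ) < i := by exact_mod_cast hi1
  set σ := min δ 1 / 22 with hσdef
  have hσ : 0 < σ := by positivity
  have hσ' : σ ≤ 1 / 22 := by
    rw [hσdef]
    gcongr
    exact min_le_right _ _
  have hσδ : 22 * σ ≤ δ := by
    rw [hσdef, mul_div_cancel₀ _ (by norm_num)]
    exact min_le_left _ _
  set κ := σ ^ 2 / 1250 / (8 * i) with hκdef
  have hκ : 0 < κ := by positivity
  have hκσ : 8 * (i * κ) = σ ^ 2 / 1250 := by
    rw [hκdef]
    field_simp
  have hlower : ∀ᶠ n : ℕ in atTop, 64 * Real.log n ^ 5 ≤ κ ^ 2 * d n := by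
    filter_upwards [hd_lower.eventually_ge_atTop (64 / κ ^ 2), hlog.eventually_gt_atTop 0]
      with n h1 h2
    rw [div_le_div_iff₀ (by positivity) (by positivity)] at h1
    linarith
  have hD : ∀ᶠ n : ℕ in atTop, 100 * d n ^ i ≤ κ * σ * n := by
    filter_upwards [hi.bound (by positivity : 0 < κ * σ / 100)] with n h1
    rw [Real.norm_eq_abs, Real.norm_natCast] at h1
    linarith [le_abs_self (d n ^ i)]
  have hlogn : ∀ᶠ n : ℕ in atTop, 1000 * Real.log n ^ 2 ≤ κ * σ * ((n : ℝ) - 1) := by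
    filter_upwards [hcast.eventually ((isLittleO_pow_log_id_atTop (n := 2)).bound
      (by positivity : 0 < κ * σ / 2000)), eventually_ge_atTop 2] with n h1 h2
    have h2' : (2 : ℝ) ≤ n := by exact_mod_cast h2
    rw [id, Real.norm_eq_abs, Real.norm_eq_abs, abs_of_nonneg (by positivity),
      abs_of_nonneg (Nat.cast_nonneg n)] at h1
    have h3 := mul_nonneg (by positivity : 0 ≤ κ * σ) (by linarith : 0 ≤ (n : ℝ) - 2)
    linarith
  have hbound : ∀ᶠ n : ℕ in atTop, 1 - (2 * i + 4) * Real.exp (-Real.log n) ≤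
      gnpProb n (p n) {G : SimpleGraph (Fin n) |
          (η n - δ) * ((d n ^ i / n + Real.exp (-c n))⁻¹ * Real.log n) ≤
            (metricDim G : ℝ) ∧
          (metricDim G : ℝ) ≤
            (1 + δ) * ((d n ^ i / n + Real.exp (-c n))⁻¹ * Real.log n)} := by
    filter_upwards [hlower, hD, hlogn, hlog.eventually_ge_atTop (1 / σ ^ 3),
      hcM (-(2 * Real.log (σ ^ 2 / 100))), hcM (4 / σ), hlog.eventually_gt_atTop 0,
      hcM 0] with n h1 h2 h3 h4 h5 h6 h7 h8
    have hd0 : 0 ≤ d n := by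
      have : 0 < κ ^ 2 * d n := lt_of_lt_of_le (by positivity) h1
      exact (pos_of_mul_pos_right this (by positivity)).le
    have hmain := gnpProb_not_metricDim_bounds_of_large (hp n).1 hi1 rfl (hd n) (hc n) (hη n) hσ
      hσ' hκ hκσ (by rwa [div_le_iff₀' (by positivity)] at h4) h1 h2 h3
      (by
        rw [← Real.le_log_iff_exp_le (by positivity)]
        linarith)
      (by rwa [div_le_iff₀' hσ] at h6)
    rw [gnpProb_compl, sub_le_comm] at hmain
    refine hmain.trans (gnpProb_mono (hp n).1 (hp n).2 fun G hG => ?_)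
    exact metricDim_bounds_mono hσδ (by positivity) hG
  refine tendsto_of_tendsto_of_tendsto_of_le_of_le' ?_ tendsto_const_nhds hbound
    (Eventually.of_forall fun n => gnpProb_le_one (hp n).1 (hp n).2 _)
  have h := ((Real.tendsto_exp_neg_atTop_nhds_zero.comp hlog).const_mul
    (2 * (i : ℝ) + 4)).const_sub 1
  simpa using h
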